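/- arXiv:2201.07553 — 3 statements merged into one kernel-verified Lean document; each statement's English description precedes it below -/
import Mathlib

section
/- Let GF(q′) be the finite field of order q′ = q^{2β}, where β is a positive integer and q is a prime power. Let e ≥ 3 be a divisor of q + 1 with (q′−1)/e > 1, and set η = ((−q)^β − 1)/e (an integer). Let I ⊂ {0, 1, …, e−1} with |I| = u and 2 ≤ u ≤ e−1, and let D′ = {C_i^e : i ∈ I}. Then: (i) each cyclotomic class C_i^e is a (q′, (q′−1)/e, η² − (e−3)η − 1, η² + η)-partial difference set; (ii) D′ is a (q′, u, (q′−1)/e, uη² + (u+2−e)η − 1, u(η²+η))-disjoint partial difference family and a (q′, u, (q′−1)/e, u(u−1)η² + 2(u−1)η, u(u−1)η²)-external partial difference family; (iii) D = ⋃_{i∈I} C_i^e is a (q′, u(q′−1)/e, u²η² + (3u−e)η − 1, u²η² + uη)-partial difference set, which is proper except when η = 1 = 2u − e or η = −1 = 2u − e. -/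
open Finset

section Defs

variable {G : Type*} [AddGroup G] [DecidableEq G]

/-- The multiset of internal differences `x - y` (`x ≠ y`) of a finset. -/
def intDiff (D : Finset G) : Multiset G :=
  ((D ×ˢ D).filter fun p => p.1 ≠ p.2).val.map fun p => p.1 - p.2

/-- The multiset of external differences `x - y`, `x ∈ D₁`, `y ∈ D₂`. -/
def extDiff (D₁ D₂ : Finset G) : Multiset G :=
  (D₁ ×ˢ D₂).val.map fun p => p.1 - p.2

variable {ι : Type*} [Fintype ι] [DecidableEq ι]

/-- The multiset of all internal differences of a family of sets. -/
def famInt (D : ι → Finset G) : Multiset G := ∑ i, intDiff (D i)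

/-- The multiset of all external differences between distinct members of a family of sets. -/
def famExt (D : ι → Finset G) : Multiset G :=
  ∑ i, ∑ j, if j = i then 0 else extDiff (D i) (D j)

/-- The union of the members of a family of sets. -/
def famU (D : ι → Finset G) : Finset G := Finset.univ.biUnion D

variable [Fintype G]

/-- `D` is an `(n,k,λ)`-difference set: `Δ(D) = λ(G*)`. -/
def IsDS (n k : ℕ) (lam : ℤ) (D : Finset G) : Prop :=
  Fintype.card G = n ∧ D.card = k ∧
    ∀ x : G, ((intDiff D).count x : ℤ) = if x = 0 then 0 else lam

/-- `P` is an `(n,k,λ,μ)`-partial difference set: `Δ(P) = λ(P) + μ(G* \ P)`. -/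
def IsPDS (n k : ℕ) (lam mu : ℤ) (P : Finset G) : Prop :=
  Fintype.card G = n ∧ P.card = k ∧
    ∀ x : G, ((intDiff P).count x : ℤ) =
      if x ∈ P then lam else if x = 0 then 0 else mu

/-- `D` is a family of `m` pairwise disjoint `k`-subsets of a group of order `n`. -/
def FamShape (n m k : ℕ) (D : ι → Finset G) : Prop :=
  Fintype.card G = n ∧ Fintype.card ι = m ∧ (∀ i, (D i).card = k) ∧
    ∀ i j, i ≠ j → Disjoint (D i) (D j)

/-- `(n,m,k,λ)`-disjoint difference family: `⋃ᵢ Δ(Dᵢ) = λ(G*)`. -/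
def IsDDF (n m k : ℕ) (lam : ℤ) (D : ι → Finset G) : Prop :=
  FamShape n m k D ∧
    ∀ x : G, ((famInt D).count x : ℤ) = if x = 0 then 0 else lam

/-- `(n,m,k,λ)`-external difference family: `⋃_{i≠j} Δ(Dᵢ,Dⱼ) = λ(G*)`. -/
def IsEDF (n m k : ℕ) (lam : ℤ) (D : ι → Finset G) : Prop :=
  FamShape n m k D ∧
    ∀ x : G, ((famExt D).count x : ℤ) = if x = 0 then 0 else lam

/-- `(n,m,k,λ,μ)`-disjoint partial difference family:
sets in `G*`, `⋃ᵢ Δ(Dᵢ) = λ(S) + μ(G* \ S)` where `S = ⋃ᵢ Dᵢ`. -/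
def IsDPDF (n m k : ℕ) (lam mu : ℤ) (D : ι → Finset G) : Prop :=
  FamShape n m k D ∧ (∀ i, (0 : G) ∉ D i) ∧
    ∀ x : G, ((famInt D).count x : ℤ) =
      if x ∈ famU D then lam else if x = 0 then 0 else mu

/-- `(n,m,k,λ,μ)`-external partial difference family:
sets in `G*`, `⋃_{i≠j} Δ(Dᵢ,Dⱼ) = λ(S) + μ(G* \ S)` where `S = ⋃ᵢ Dᵢ`. -/
def IsEPDF (n m k : ℕ) (lam mu : ℤ) (D : ι → Finset G) : Prop :=
  FamShape n m k D ∧ (∀ i, (0 : G) ∉ D i) ∧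
    ∀ x : G, ((famExt D).count x : ℤ) =
      if x ∈ famU D then lam else if x = 0 then 0 else mu

end Defs

section FieldDefs

variable {F : Type*} [Field F] [DecidableEq F]

/-- `α` is a primitive element: every nonzero element is a power of `α`. -/
def IsPrimitiveElt (α : F) : Prop := ∀ x : F, x ≠ 0 → ∃ k : ℕ, x = α ^ k

/-- The coset `α^i⟨α^e⟩` of the cyclotomic class of order `e` (of size `f`). -/
def cyclo (α : F) (e f i : ℕ) : Finset F :=
  (Finset.range f).image fun j => α ^ (i + e * j)

/-- The cyclotomic number `(i,j)_e`: the number of pairs `(zᵢ, zⱼ) ∈ Cᵢ × Cⱼ` with `zᵢ + 1 = zⱼ`. -/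
def cycNum (α : F) (e f i j : ℕ) : ℕ :=
  ((cyclo α e f i ×ˢ cyclo α e f j).filter fun p => p.1 + 1 = p.2).card

/-- `Φᵢ = {x ∈ C₀^e : x ≠ 1, x - 1 ∈ α^i C₀^ε}`. -/
def Phi (α : F) (e f ε ρ i : ℕ) : Finset F :=
  (cyclo α e f 0).filter fun x => x ≠ 1 ∧ x - 1 ∈ cyclo α ε ρ i

/-- `φᵢ = |Φᵢ|`. -/
def phi (α : F) (e f ε ρ i : ℕ) : ℕ := (Phi α e f ε ρ i).card

end FieldDefs

section Helpers

set_option linter.unusedSectionVars false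

variable {F : Type*} [Field F] [Fintype F] [DecidableEq F]

lemma ord_alpha (α : F) (hα : IsPrimitiveElt α) (h2 : 2 < Fintype.card F) :
    IsPrimitiveRoot α (Fintype.card F - 1) := by
  have h0 : α ≠ 0 := by
    rintro rfl
    have : (Finset.univ : Finset F) ⊆ {0, 1} := by
      intro x _
      by_cases hx : x = 0
      · simp [hx]
      · obtain ⟨k, hk⟩ := hα x hx
        rcases Nat.eq_zero_or_pos k with rfl | hk'
        · simp [hk]
        · rw [zero_pow hk'.ne'] at hk
          exact absurd hk hx
    have h3 := Finset.card_le_card this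
    have h4 : ({0, 1} : Finset F).card ≤ 2 := Finset.card_le_two
    rw [Finset.card_univ] at h3
    omega
  have h1 : orderOf (Units.mk0 α h0) = Nat.card Fˣ := by
    apply orderOf_eq_card_of_forall_mem_zpowers
    intro x
    obtain ⟨k, hk⟩ := hα x x.ne_zero
    refine ⟨k, ?_⟩
    ext
    simp [hk]
  have h3 : orderOf α = Fintype.card F - 1 := by
    rw [← Fintype.card_units, ← Nat.card_eq_fintype_card, ← h1, ← orderOf_units]
    rfl
  rw [← h3]
  exact IsPrimitiveRoot.orderOf α

lemma card_pow_fiber {α : F} {N : ℕ} (hα : IsPrimitiveRoot α N) (hN : 0 < N) {d d' : ℕ}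
    (h : N = d' * d) {y : F} (hy : y ≠ 0) :
    (Finset.univ.filter fun x : F => x ^ d = y ^ d).card = d := by
  have hd : 0 < d := Nat.pos_of_ne_zero (by rintro rfl; simp at h; omega)
  have h1 := hα.pow hN h
  have : (Finset.univ.filter fun x : F => x ^ d = y ^ d)
      = (Polynomial.nthRootsFinset d (1 : F)).image (fun x => y * x) := by
    ext x
    simp only [Finset.mem_filter, Finset.mem_univ, true_and, Finset.mem_image,
      Polynomial.mem_nthRootsFinset hd]
    constructor
    · intro hx
      refine ⟨x / y, ?_, by field_simp⟩
      rw [div_pow, hx, div_self (pow_ne_zero _ hy)]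
    · rintro ⟨z, hz, rfl⟩
      rw [mul_pow, hz, mul_one]
  rw [this, Finset.card_image_of_injective _ (mul_right_injective₀ hy),
    h1.card_nthRootsFinset]

lemma exists_root {α : F} (hp : IsPrimitiveElt α) {N : ℕ} (hα : IsPrimitiveRoot α N)
    {d d' : ℕ} (h : N = d' * d) (hN : 0 < N) {x : F} (hx0 : x ≠ 0) (hx : x ^ d = 1) :
    ∃ y : F, y ≠ 0 ∧ x = y ^ d' := by
  have hd : 0 < d := Nat.pos_of_ne_zero (by rintro rfl; simp at h; omega)
  obtain ⟨k, rfl⟩ := hp x hx0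
  rw [← pow_mul] at hx
  have h1 := (hα.pow_eq_one_iff_dvd _).1 hx
  rw [h] at h1
  obtain ⟨m, rfl⟩ := Nat.dvd_of_mul_dvd_mul_right hd h1
  refine ⟨α ^ m, pow_ne_zero _ (hα.ne_zero hN.ne'), ?_⟩
  rw [← pow_mul, mul_comm]

lemma exists_psi (q b : ℕ) (hq : IsPrimePow q) (hcard : Fintype.card F = q ^ b) :
    (∀ x y : F, (x + y) ^ q = x ^ q + y ^ q) ∧
    ∃ ψ : AddChar F ℂ, ψ.IsPrimitive ∧ ∀ x, ψ (x ^ q) = ψ x := by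
  obtain ⟨p, n, hp, hn, rfl⟩ := hq
  have hp' : p.Prime := Nat.prime_iff.2 hp
  have : Fact p.Prime := ⟨hp'⟩
  have : CharP F p := by
    obtain ⟨r, hr⟩ := CharP.exists F
    obtain ⟨k, hrp, hk⟩ := FiniteField.card F r
    rw [hk, ← pow_mul] at hcard
    have : r ∣ p := by
      have h1 : r ∣ p ^ (n * b) := hcard ▸ dvd_pow_self r k.ne_zero
      exact hrp.dvd_of_dvd_pow h1
    rw [(Nat.prime_dvd_prime_iff_eq hrp hp').1 this] at hr
    exact hr
  let _ := ZMod.algebra F p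
  refine ⟨fun x y => add_pow_char_pow .., ?_⟩
  let φ := (ZMod.stdAddChar (N := p)).compAddMonoidHom (Algebra.trace (ZMod p) F).toAddMonoidHom
  have hφ : ∀ x, φ x = ZMod.stdAddChar (N := p) (Algebra.trace (ZMod p) F x) := fun x => rfl
  refine ⟨φ, ?_, ?_⟩
  · apply AddChar.IsPrimitive.of_ne_one
    intro h1
    have h2 : ∀ b : F, Algebra.trace (ZMod p) F b = 0 := by
      intro b
      have h3 : φ b = 1 := by rw [h1]; rfl
      rw [hφ] at h3
      apply ZMod.injective_stdAddChar (N := p)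
      rw [h3, AddChar.map_zero_eq_one]
    have htr := (traceForm_nondegenerate (ZMod p) F).1 1
    simp_rw [Algebra.traceForm_apply] at htr
    exact one_ne_zero (htr fun b => h2 _)
  · intro x
    have key : ∀ x, φ (x ^ p) = φ x := by
      intro x
      rw [hφ, hφ]
      have := Algebra.trace_eq_of_algEquiv (FiniteField.frobeniusAlgEquivOfAlgebraic (ZMod p) F) x
      rw [← this]
      simp [ZMod.card]
    clear hn hcard
    induction n generalizing x with
    | zero => simp
    | succ n ih => rw [pow_succ, pow_mul, key, ih]

lemma sum_psi {ψ : AddChar F ℂ} (hψ : ψ.IsPrimitive) (b : F) :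
    ∑ y, ψ (b * y) = if b = 0 then (Fintype.card F : ℂ) else 0 := by
  have := AddChar.sum_mulShift b hψ
  simp only [mul_comm b]
  rw [this]
  split_ifs <;> simp

lemma S_sq {ψ : AddChar F ℂ} (hψ : ψ.IsPrimitive) {q : ℕ} (hq0 : 0 < q)
    (hadd : ∀ x y : F, (x + y) ^ q = x ^ q + y ^ q)
    (hψq : ∀ x, ψ (x ^ q) = ψ x)
    {ν θ : F} (hν : ν ^ (q + 1) = -1) (hθ : (θ ^ q) ^ q = θ) (hθ' : θ + θ ^ q ≠ 0) (a : F) :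
    (∑ x, ψ (a * x ^ (q + 1))) ^ 2 = (Fintype.card F : ℂ) *
      ((Finset.univ.filter fun z : F => a * z + a ^ q * (z ^ q) ^ q = 0).card : ℂ) := by
  have hneg : ∀ x : F, (-x) ^ q = - x ^ q := by
    intro x
    have := hadd x (-x)
    rw [add_neg_cancel, zero_pow hq0.ne'] at this
    linear_combination -this
  have hν0 : ν ≠ 0 := by
    rintro rfl
    simp at hν
  have hinj : Function.Injective (fun y : F => y ^ q) := by
    intro x y hxy
    have h1 := hadd x (-y)
    have hxy' : x ^ q = y ^ q := hxy
    rw [hneg, hxy', add_neg_cancel] at h1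
    have := pow_eq_zero_iff hq0.ne' |>.1 h1
    linear_combination this
  have hbij : Function.Bijective (fun y : F => y ^ q) := Finite.injective_iff_bijective.1 hinj
  have hS : ∑ x, ψ (a * x ^ (q + 1)) = ∑ x, ψ (-(a * x ^ (q + 1))) := by
    rw [← (mulLeft_bijective₀ ν hν0).sum_comp]
    refine Finset.sum_congr rfl fun x _ => ?_
    rw [mul_pow, hν]
    congr 1
    ring
  have hone : ∀ w : F, w ^ q = -w → ψ w = 1 := by
    intro w hw
    set c := θ + θ ^ q with hc
    have hcq : c ^ q = c := by rw [hc, hadd, hθ, add_comm]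
    have h1 : w = w * θ / c + -((w * θ / c) ^ q) := by
      rw [div_pow, mul_pow, hw, hcq]
      field_simp
      rw [hc]
    rw [h1, AddChar.map_add_eq_mul, AddChar.map_neg_eq_inv, hψq]
    exact mul_inv_cancel₀ (by
      intro h0
      have := AddChar.map_add_eq_mul ψ (w * θ / c) (-(w * θ / c))
      rw [h0] at this
      simp at this)
  calc (∑ x, ψ (a * x ^ (q + 1))) ^ 2
      = (∑ x, ψ (a * x ^ (q + 1))) * (∑ y, ψ (-(a * y ^ (q + 1)))) := by rw [← hS, sq]
    _ = ∑ y, ∑ x, ψ (a * x ^ (q + 1)) * ψ (-(a * y ^ (q + 1))) := by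
        rw [Finset.sum_mul_sum, Finset.sum_comm]
    _ = ∑ y, ∑ z, ψ (a * (z + y) ^ (q + 1)) * ψ (-(a * y ^ (q + 1))) := by
        refine Finset.sum_congr rfl fun y _ => ?_
        exact ((Equiv.addRight y).bijective.sum_comp
          (fun x => ψ (a * x ^ (q + 1)) * ψ (-(a * y ^ (q + 1))))).symm
    _ = ∑ y, ∑ z, ψ (a * z ^ (q + 1)) * ψ ((a * z + a ^ q * (z ^ q) ^ q) * y ^ q) := by
        refine Finset.sum_congr rfl fun y _ => Finset.sum_congr rfl fun z _ => ?_
        have h1 : ψ ((a * z + a ^ q * (z ^ q) ^ q) * y ^ q)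
            = ψ (a * z * y ^ q) * ψ (a * z ^ q * y) := by
          rw [← hψq (a * z ^ q * y), ← AddChar.map_add_eq_mul]
          congr 1
          rw [mul_pow, mul_pow]; ring
        rw [h1, ← AddChar.map_add_eq_mul, ← AddChar.map_add_eq_mul, ← AddChar.map_add_eq_mul]
        congr 1
        rw [pow_succ (z + y), hadd]
        ring
    _ = ∑ z, ψ (a * z ^ (q + 1)) *
          if a * z + a ^ q * (z ^ q) ^ q = 0 then (Fintype.card F : ℂ) else 0 := by
        rw [Finset.sum_comm]
        refine Finset.sum_congr rfl fun z _ => ?_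
        rw [← Finset.mul_sum, ← sum_psi hψ]
        congr 1
        exact hbij.sum_comp (fun y => ψ ((a * z + a ^ q * (z ^ q) ^ q) * y))
    _ = ∑ z, if a * z + a ^ q * (z ^ q) ^ q = 0 then (Fintype.card F : ℂ) else 0 := by
        refine Finset.sum_congr rfl fun z _ => ?_
        split_ifs with h
        · rw [hone, one_mul]
          rw [pow_succ, mul_pow, mul_pow]
          linear_combination z ^ q * h
        · simp
    _ = _ := by
        rw [← Finset.sum_filter, Finset.sum_const, nsmul_eq_mul, mul_comm]

lemma int_of_integral {P : ℂ} (hP : IsIntegral ℤ P) (m c : ℤ) (hm : m ≠ 0)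
    (h : (m : ℂ) * P = c) : m ∣ c := by
  have hm' : (m : ℂ) ≠ 0 := by exact_mod_cast hm
  have h1 : P = algebraMap ℚ ℂ ((c : ℚ) / m) := by
    simp only [eq_ratCast, Rat.cast_div, Rat.cast_intCast]
    field_simp
    linear_combination h
  rw [h1, isIntegral_algebraMap_iff (algebraMap ℚ ℂ).injective,
    IsIntegrallyClosed.isIntegral_iff] at hP
  obtain ⟨k, hk⟩ := hP
  refine ⟨k, ?_⟩
  have hm'' : (m : ℚ) ≠ 0 := by exact_mod_cast hm
  simp only [algebraMap_int_eq, eq_intCast] at hk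
  field_simp at hk
  rw [mul_comm]
  exact_mod_cast hk.symm

lemma psi_integral (ψ : AddChar F ℂ) (x : F) : IsIntegral ℤ (ψ x) := by
  have h : ψ x ^ Fintype.card F = 1 := by
    rw [← AddChar.map_nsmul_eq_pow, card_nsmul_eq_zero, AddChar.map_zero_eq_one]
  exact IsIntegral.of_pow Fintype.card_pos (h ▸ isIntegral_one)

lemma S_integral (ψ : AddChar F ℂ) {α : F} {N : ℕ} (hα : IsPrimitiveRoot α N) (hN : 0 < N)
    {q n : ℕ} (h : N = n * (q + 1)) (a : F) :
    ∃ P : ℂ, IsIntegral ℤ P ∧ ∑ x, ψ (a * x ^ (q + 1)) = 1 + ((q + 1 : ℤ) : ℂ) * P := by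
  classical
  refine ⟨∑ y ∈ (Finset.univ.erase (0 : F)).image (fun x => x ^ (q + 1)), ψ (a * y),
    IsIntegral.sum _ fun y _ => psi_integral _ _, ?_⟩
  rw [← Finset.add_sum_erase _ _ (Finset.mem_univ (0 : F))]
  congr 1
  · simp
  · rw [Finset.sum_comp (fun y => ψ (a * y)) (fun x : F => x ^ (q + 1)), Finset.mul_sum]
    refine Finset.sum_congr rfl fun y hy => ?_
    obtain ⟨x, hx, rfl⟩ := Finset.mem_image.1 hy
    have hx0 : x ≠ 0 := Finset.ne_of_mem_erase hx
    have h1 := card_pow_fiber hα hN h hx0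
    have h2 : (Finset.univ.erase (0 : F)).filter (fun z => z ^ (q + 1) = x ^ (q + 1))
        = Finset.univ.filter fun z : F => z ^ (q + 1) = x ^ (q + 1) := by
      ext z
      simp only [Finset.mem_filter, Finset.mem_erase, Finset.mem_univ, and_true, true_and,
        and_iff_right_iff_imp]
      rintro hz rfl
      rw [zero_pow (by omega)] at hz
      exact hx0 (pow_eq_zero_iff (by omega) |>.1 hz.symm)
    rw [h2, h1]
    simp

lemma K_card {α : F} (hp : IsPrimitiveElt α) {N : ℕ} (hα : IsPrimitiveRoot α N) (hN : 0 < N)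
    (hNc : Fintype.card F = N + 1)
    {q M : ℕ} (hq : 2 ≤ q) (h : N = (q - 1) * (q + 1) * M)
    {t : F} (ht : t ^ (q - 1) = -1) {a : F} (ha : a ≠ 0) :
    (Finset.univ.filter fun z : F => a * z + a ^ q * (z ^ q) ^ q = 0).card
      = if a ^ ((q - 1) * M) = t ^ ((q - 1) * M) then q ^ 2 else 1 := by
  have hpow : ∀ x : F, x ≠ 0 → x ^ N = 1 := by
    intro x hx
    have := FiniteField.pow_card_sub_one_eq_one x hx
    rwa [hNc, Nat.add_sub_cancel] at this
  have ht0 : t ≠ 0 := by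
    rintro rfl
    rw [zero_pow (by omega)] at ht
    simp at ht
  obtain ⟨s, rfl⟩ : ∃ s, q = s + 1 := ⟨q - 1, by omega⟩
  simp only [Nat.add_sub_cancel] at *
  have hiff : ∀ z : F, a * z + a ^ (s + 1) * (z ^ (s + 1)) ^ (s + 1) = 0 ↔
      z = 0 ∨ a ^ s * z ^ (s * (s + 1 + 1)) = -1 := by
    intro z
    have : a * z + a ^ (s + 1) * (z ^ (s + 1)) ^ (s + 1)
        = a * z * (1 + a ^ s * z ^ (s * (s + 1 + 1))) := by ring
    rw [this, mul_eq_zero, mul_eq_zero]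
    simp only [ha, false_or]
    constructor
    · rintro (h | h)
      · exact Or.inl h
      · right; linear_combination h
    · rintro (h | h)
      · exact Or.inl h
      · right; linear_combination h
  simp_rw [hiff]
  split_ifs with hc
  · obtain ⟨y, hy0, hy⟩ := exists_root hp hα (d := s * M) (d' := s + 1 + 1) (by rw [h]; ring) hN
      (x := a / t) (div_ne_zero ha ht0)
      (by rw [div_pow, hc, div_self (pow_ne_zero _ ht0)])
    have hay : a = t * y ^ (s + 1 + 1) := by rw [← hy]; field_simp
    have h1 : (Finset.univ.filter fun z : F => z = 0 ∨ a ^ s * z ^ (s * (s + 1 + 1)) = -1)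
        = insert 0 (Finset.univ.filter
          fun z : F => z ^ (s * (s + 1 + 1)) = (y⁻¹) ^ (s * (s + 1 + 1))) := by
      ext z
      simp only [Finset.mem_filter, Finset.mem_univ, true_and, Finset.mem_insert]
      have : a ^ s = - y ^ (s * (s + 1 + 1)) := by
        rw [hay, mul_pow, ht, ← pow_mul, mul_comm s]; ring
      have hY := pow_ne_zero (s * (s + 1 + 1)) hy0
      rw [this, inv_pow]
      constructor
      · rintro (h | h)
        · exact Or.inl h
        · right
          apply eq_inv_of_mul_eq_one_left
          linear_combination -h
      · rintro (h | h)
        · exact Or.inl h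
        · right
          rw [h, neg_mul, mul_inv_cancel₀ hY]
    rw [h1, Finset.card_insert_of_notMem, card_pow_fiber hα hN (d' := M) (by rw [h]; ring)
      (inv_ne_zero hy0)]
    · ring
    · have h3 : s * (s + 1 + 1) ≠ 0 := mul_ne_zero (by omega) (by omega)
      simp only [Finset.mem_filter, Finset.mem_univ, true_and, zero_pow h3]
      exact (pow_ne_zero _ (inv_ne_zero hy0)).symm
  · rw [Finset.card_eq_one]
    refine ⟨0, ?_⟩
    ext z
    simp only [Finset.mem_filter, Finset.mem_univ, true_and, Finset.mem_singleton, or_iff_left_iff_imp]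
    intro hz
    by_contra hz0
    apply hc
    have h2 : (a * z ^ (s + 1 + 1) / t) ^ s = 1 := by
      rw [div_pow, ht, mul_pow, ← pow_mul, mul_comm _ s, hz]
      simp
    obtain ⟨y, hy0, hy⟩ := exists_root hp hα (d := s) (d' := (s + 1 + 1) * M)
      (by rw [h]; ring) hN (div_ne_zero (mul_ne_zero ha (pow_ne_zero _ hz0)) ht0) h2
    have h3 : (a * z ^ (s + 1 + 1) / t) ^ (s * M) = 1 := by
      rw [hy, ← pow_mul, show (s + 1 + 1) * M * (s * M) = N * M by rw [h]; ring, pow_mul,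
        hpow y hy0, one_pow]
    rw [div_pow, mul_pow, ← pow_mul, show (s + 1 + 1) * (s * M) = N by rw [h]; ring,
      hpow z hz0, mul_one, div_eq_one_iff_eq (pow_ne_zero _ ht0)] at h3
    exact h3

lemma S_val {α : F} (hp : IsPrimitiveElt α) {N : ℕ} (hα : IsPrimitiveRoot α N) (hN : 0 < N)
    (hNc : Fintype.card F = N + 1)
    {q M β : ℕ} (hq : 2 ≤ q) (hQ : Fintype.card F = q ^ (2 * β)) (h : N = (q - 1) * (q + 1) * M)
    {ψ : AddChar F ℂ} (hψ : ψ.IsPrimitive)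
    (hadd : ∀ x y : F, (x + y) ^ q = x ^ q + y ^ q)
    (hψq : ∀ x, ψ (x ^ q) = ψ x)
    {ν θ : F} (hν : ν ^ (q + 1) = -1) (hθ : (θ ^ q) ^ q = θ) (hθ' : θ + θ ^ q ≠ 0)
    {t : F} (ht : t ^ (q - 1) = -1) {a : F} (ha : a ≠ 0) :
    ∑ x, ψ (a * x ^ (q + 1)) = (((-(q : ℤ)) ^ β : ℤ) : ℂ) *
      (1 - ((q : ℂ) + 1) * if a ^ ((q - 1) * M) = t ^ ((q - 1) * M) then 1 else 0) := by
  have h1 := S_sq hψ (by omega) hadd hψq hν hθ hθ' a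
  rw [K_card hp hα hN hNc hq h ht ha, hQ] at h1
  obtain ⟨P, hP, hS⟩ := S_integral ψ hα hN (q := q) (n := (q - 1) * M) (by rw [h]; ring) a
  set S := ∑ x, ψ (a * x ^ (q + 1)) with hSdef
  set r : ℤ := (-(q : ℤ)) ^ β with hr
  have hr2 : ((q ^ (2 * β) : ℕ) : ℂ) = (r : ℂ) ^ 2 := by
    rw [hr]; push_cast
    rw [← pow_mul, mul_comm β 2, pow_mul, pow_mul, neg_sq]
  have hrm : ((q : ℤ) + 1) ∣ r - 1 := by
    have := sub_dvd_pow_sub_pow (-(q : ℤ)) 1 β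
    rw [one_pow] at this
    have h3 : ((q : ℤ) + 1) ∣ -(q : ℤ) - 1 := ⟨-1, by ring⟩
    exact h3.trans this
  have hqne : ((q : ℤ) + 1) ≠ 0 := by positivity
  have hno : ¬ ((q : ℤ) + 1) ∣ 2 := by
    intro h
    have := Int.le_of_dvd (by norm_num) h
    omega
  rw [hr2] at h1
  split_ifs at h1 ⊢ with hc
  · have : (S - r * q) * (S + r * q) = 0 := by
      push_cast at h1
      linear_combination h1
    rcases mul_eq_zero.1 this with h2 | h2
    · exfalso
      have := int_of_integral hP (q + 1) (r * q - 1) hqne (by push_cast at hS ⊢; linear_combination h2 - hS)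
      apply hno
      have e1 : (2 : ℤ) = r * (q + 1) - (r * q - 1) - (r - 1) := by ring
      rw [e1]
      exact dvd_sub (dvd_sub (Dvd.intro_left _ rfl) this) hrm
    · linear_combination h2
  · have : (S - r) * (S + r) = 0 := by
      push_cast at h1
      linear_combination h1
    rcases mul_eq_zero.1 this with h2 | h2
    · linear_combination h2
    · exfalso
      have := int_of_integral hP (q + 1) (-r - 1) hqne (by push_cast at hS ⊢; linear_combination h2 - hS)
      apply hno
      have e1 : (2 : ℤ) = - (-r - 1) - (r - 1) := by ring
      rw [e1]
      exact dvd_sub ((dvd_neg).2 this) hrm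

/-- The class of `b`. -/
def cls (f : ℕ) (b : F) : Finset F := Finset.univ.filter fun x : F => x ^ f = b ^ f

lemma mem_cls {f : ℕ} {b x : F} : x ∈ cls f b ↔ x ^ f = b ^ f := by simp [cls]

lemma period {α : F} {N : ℕ} (hα : IsPrimitiveRoot α N) (hN : 0 < N)
    (hNc : Fintype.card F = N + 1) {ψ : AddChar F ℂ}
    {q n m e f : ℕ} (hn : N = (q + 1) * n) (hf : f = n * m) (hm : q + 1 = e * m)
    {r η : ℤ} (hη : (e : ℤ) * η = r - 1) {t : F} (ht0 : t ≠ 0)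
    (hS : ∀ a : F, a ≠ 0 → ∑ x, ψ (a * x ^ (q + 1)) = (r : ℂ) *
      (1 - ((q : ℂ) + 1) * if a ^ n = t ^ n then 1 else 0))
    {a b : F} (ha : a ≠ 0) (hb : b ≠ 0) :
    ∑ x ∈ cls f b, ψ (a * x) = η - (r : ℂ) * if (a * b) ^ f = t ^ f then 1 else 0 := by
  have hNf : N = e * f := by rw [hn, hf, hm]; ring
  have hpow : ∀ x : F, x ≠ 0 → x ^ N = 1 := by
    intro x hx
    have := FiniteField.pow_card_sub_one_eq_one x hx
    rwa [hNc, Nat.add_sub_cancel] at this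
  have hf0 : f ≠ 0 := by rintro rfl; omega
  have hcls0 : ∀ x ∈ cls f b, x ≠ 0 := by
    rintro x hx rfl
    rw [mem_cls, zero_pow hf0] at hx
    exact pow_ne_zero _ hb hx.symm
  have hcardcls : (cls f b).card = f := card_pow_fiber hα hN hNf hb
  have h1 : ∀ z : F, z ≠ 0 →
      ∑ x ∈ cls f b, ψ (a * x * z ^ (q + 1)) = ∑ x ∈ cls f b, ψ (a * x) := by
    intro z hz
    have hzf : (z ^ (q + 1)) ^ f = 1 := by
      rw [← pow_mul, hm, show e * m * f = N * m by rw [hNf]; ring, pow_mul, hpow z hz, one_pow]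
    have hz1 := pow_ne_zero (q + 1) hz
    refine Finset.sum_bij' (fun x _ => x * z ^ (q + 1)) (fun x _ => x / z ^ (q + 1)) ?_ ?_ ?_ ?_ ?_
    · intro x hx
      rw [mem_cls] at *
      rw [mul_pow, hzf, mul_one, hx]
    · intro x hx
      rw [mem_cls] at *
      rw [div_pow, hzf, div_one, hx]
    · intro x _
      field_simp
    · intro x _
      field_simp
    · intro x _
      rw [mul_assoc]
  have h2 : (N : ℂ) * ∑ x ∈ cls f b, ψ (a * x)
      = ∑ x ∈ cls f b, (∑ z, ψ (a * x * z ^ (q + 1)) - 1) := by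
    have : ∀ x, ∑ z, ψ (a * x * z ^ (q + 1)) - 1
        = ∑ z ∈ Finset.univ.erase (0 : F), ψ (a * x * z ^ (q + 1)) := by
      intro x
      rw [← Finset.add_sum_erase _ _ (Finset.mem_univ (0 : F))]
      simp
    simp_rw [this]
    rw [Finset.sum_comm, Finset.sum_congr rfl
      (fun z hz => h1 z (Finset.ne_of_mem_erase hz)), Finset.sum_const,
      Finset.card_erase_of_mem (Finset.mem_univ _), Finset.card_univ, hNc]
    simp
  have h3 : ∑ x ∈ cls f b, (∑ z, ψ (a * x * z ^ (q + 1)) - 1)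
      = f * ((r : ℂ) - 1) - r * (q + 1) *
        (((cls f b).filter fun x => (a * x) ^ n = t ^ n).card : ℂ) := by
    rw [Finset.sum_congr rfl (fun x hx => by rw [hS (a * x) (mul_ne_zero ha (hcls0 x hx))]),
      Finset.card_filter]
    push_cast
    have hfs : (f : ℂ) * ((r : ℂ) - 1) = ∑ x ∈ cls f b, ((r : ℂ) - 1) := by
      rw [Finset.sum_const, hcardcls, nsmul_eq_mul]
    rw [Finset.mul_sum, hfs, ← Finset.sum_sub_distrib]
    refine Finset.sum_congr rfl fun x _ => ?_
    ring
  have h4 : ((cls f b).filter fun x => (a * x) ^ n = t ^ n).card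
      = if (a * b) ^ f = t ^ f then n else 0 := by
    split_ifs with hc
    · refine Eq.trans ?_
        (card_pow_fiber hα hN (d := n) (d' := q + 1) hn (y := t / a) (div_ne_zero ht0 ha))
      congr 1
      ext x
      simp only [Finset.mem_filter, mem_cls, Finset.mem_univ, true_and]
      have han := pow_ne_zero n ha
      have haf := pow_ne_zero f ha
      rw [div_pow, eq_div_iff han, ← mul_pow, mul_comm x]
      constructor
      · exact fun h => h.2
      · intro h
        refine ⟨?_, h⟩
        have : (a * x) ^ f = (a * b) ^ f := by rw [hc, hf, pow_mul, h, ← pow_mul]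
        rw [mul_pow, mul_pow] at this
        exact mul_left_cancel₀ haf this
    · rw [Finset.card_eq_zero, Finset.filter_eq_empty_iff]
      intro x hx h
      apply hc
      rw [mem_cls] at hx
      rw [mul_pow, ← hx, ← mul_pow, hf, pow_mul, h, ← pow_mul]
  have hNC : (N : ℂ) ≠ 0 := by exact_mod_cast hN.ne'
  apply mul_left_cancel₀ hNC
  rw [h2, h3, h4]
  have hηC : (e : ℂ) * η = r - 1 := by exact_mod_cast hη
  have e1 : (N : ℂ) = e * f := by rw [hNf]; push_cast; ring
  have e2 : (N : ℂ) = (q + 1) * n := by rw [hn]; push_cast; ring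
  split_ifs
  · linear_combination (-(f : ℂ)) * hηC - (η : ℂ) * e1 + r * e2
  · push_cast
    linear_combination (-(f : ℂ)) * hηC - (η : ℂ) * e1

/-- number of representations as difference -/
def reps (A B : Finset F) (x : F) : ℤ := ∑ y ∈ A, ∑ z ∈ B, if y - z = x then 1 else 0

lemma reps_cls {α : F} {N : ℕ} (hα : IsPrimitiveRoot α N) (hN : 0 < N)
    (hNc : Fintype.card F = N + 1) {ψ : AddChar F ℂ} (hψ : ψ.IsPrimitive)
    {e f : ℕ} (hNf : N = e * f) (hneg : (-1 : F) ^ f = 1)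
    {r η : ℤ} (hη : (e : ℤ) * η = r - 1) (hr : (Fintype.card F : ℤ) = r ^ 2) {t : F} (ht0 : t ≠ 0)
    (hP : ∀ a b : F, a ≠ 0 → b ≠ 0 →
      ∑ x ∈ cls f b, ψ (a * x) = η - (r : ℂ) * if (a * b) ^ f = t ^ f then 1 else 0)
    {b c : F} (hb : b ≠ 0) (hc : c ≠ 0) {x : F} (hx : x ≠ 0) :
    reps (cls f b) (cls f c) x = η ^ 2 + η * ((if x ∈ cls f b then 1 else 0) +
      (if x ∈ cls f c then 1 else 0)) +
      (if b ^ f = c ^ f then η - r * (if x ∈ cls f b then 1 else 0) else 0) := by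
  have hf0 : f ≠ 0 := by rintro rfl; omega
  have hcardcls : ∀ b : F, b ≠ 0 → (cls f b).card = f := fun b hb => card_pow_fiber hα hN hNf hb
  have hnegf : ∀ y : F, (-y) ^ f = y ^ f := by
    intro y
    rw [neg_eq_neg_one_mul, mul_pow, hneg, one_mul]
  have h0 : ∀ w : F, (Fintype.card F : ℂ) * (if w = x then 1 else 0)
      = ∑ a, ψ (a * w) * ψ (-(a * x)) := by
    intro w
    have := sum_psi hψ (w - x)
    simp only [sub_eq_zero] at this
    rw [mul_ite, mul_one, mul_zero, ← this]
    refine Finset.sum_congr rfl fun a _ => ?_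
    rw [← AddChar.map_add_eq_mul]
    congr 1
    ring
  have h1 : (Fintype.card F : ℂ) * (reps (cls f b) (cls f c) x : ℂ) =
      ∑ a, (∑ y ∈ cls f b, ψ (a * y)) * (∑ z ∈ cls f c, ψ (-a * z)) * ψ (-(a * x)) := by
    unfold reps
    push_cast
    simp_rw [Finset.mul_sum, h0, Finset.sum_mul]
    rw [Finset.sum_comm]
    simp_rw [Finset.sum_comm (s := cls f b) (t := Finset.univ)]
    rw [Finset.sum_comm]
    refine Finset.sum_congr rfl fun a _ => ?_
    refine Finset.sum_congr rfl fun z _ => ?_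
    refine Finset.sum_congr rfl fun y _ => ?_
    congr 1
    rw [← AddChar.map_add_eq_mul]
    congr 1
    ring
  have hA : ∀ b : F, b ≠ 0 →
      ∑ a ∈ Finset.univ.erase (0 : F), (if (a * b) ^ f = t ^ f then 1 else 0) * ψ (-(a * x))
        = η - (r : ℂ) * if x ∈ cls f b then 1 else 0 := by
    intro b hb
    have hbf := pow_ne_zero f hb
    have htf := pow_ne_zero f ht0
    have e1 := hP (-x) (t / b) (neg_ne_zero.2 hx) (div_ne_zero ht0 hb)
    have e2 : (-x * (t / b)) ^ f = t ^ f ↔ x ∈ cls f b := by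
      rw [mem_cls, mul_pow, hnegf, div_pow]
      field_simp
    simp only [e2] at e1
    rw [← e1]
    simp only [ite_mul, one_mul, zero_mul]
    rw [← Finset.sum_filter]
    apply Finset.sum_congr
    · ext a
      simp only [Finset.mem_filter, Finset.mem_erase, Finset.mem_univ, and_true, mem_cls]
      rw [div_pow, eq_div_iff hbf, mul_pow]
      constructor
      · exact fun h => h.2
      · intro h
        refine ⟨?_, h⟩
        rintro rfl
        rw [zero_pow hf0, zero_mul] at h
        exact htf h.symm
    · intro a _
      congr 1
      ring
  have hB : ∑ a ∈ Finset.univ.erase (0 : F), ψ (-(a * x)) = -1 := by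
    have := sum_psi hψ (-x)
    rw [if_neg (neg_ne_zero.2 hx), ← Finset.add_sum_erase _ _ (Finset.mem_univ (0 : F))] at this
    simp only [mul_zero, AddChar.map_zero_eq_one] at this
    rw [Finset.sum_congr rfl (g := fun a => ψ (-x * a)) (fun a _ => by congr 1; ring)]
    linear_combination this
  have h2 : (Fintype.card F : ℂ) * (reps (cls f b) (cls f c) x : ℂ) =
      (f : ℂ) ^ 2 + ∑ a ∈ Finset.univ.erase (0 : F),
        ((η : ℂ) ^ 2 * ψ (-(a * x))
          - r * η * ((if (a * b) ^ f = t ^ f then 1 else 0) * ψ (-(a * x)))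
          - r * η * ((if (a * c) ^ f = t ^ f then 1 else 0) * ψ (-(a * x)))
          + (if b ^ f = c ^ f then (r : ℂ) ^ 2 else 0) *
            ((if (a * b) ^ f = t ^ f then 1 else 0) * ψ (-(a * x)))) := by
    rw [h1, ← Finset.add_sum_erase _ _ (Finset.mem_univ (0 : F))]
    congr 1
    · simp [hcardcls b hb, hcardcls c hc]
      ring
    · refine Finset.sum_congr rfl fun a ha => ?_
      have ha0 : a ≠ 0 := Finset.ne_of_mem_erase ha
      rw [hP a b ha0 hb, hP (-a) c (neg_ne_zero.2 ha0) hc, neg_mul, hnegf]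
      have key : (if (a * b) ^ f = t ^ f then (1 : ℂ) else 0) * (if (a * c) ^ f = t ^ f then 1 else 0)
          = (if b ^ f = c ^ f then 1 else 0) * (if (a * b) ^ f = t ^ f then 1 else 0) := by
        have haf := pow_ne_zero f ha0
        by_cases hbc : b ^ f = c ^ f
        · rw [mul_pow, mul_pow, hbc, if_pos rfl]
          split_ifs <;> simp
        · rw [if_neg hbc, zero_mul]
          split_ifs with g1 g2
          · exfalso
            apply hbc
            rw [← g2, mul_pow, mul_pow] at g1
            exact mul_left_cancel₀ haf g1
          · simp
          · simp
          · simp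
      have key2 : (if b ^ f = c ^ f then (r : ℂ) ^ 2 else 0)
          = r ^ 2 * (if b ^ f = c ^ f then 1 else 0) := by split_ifs <;> simp
      rw [key2]
      linear_combination (r : ℂ) ^ 2 * ψ (-(a * x)) * key
  rw [Finset.sum_add_distrib, Finset.sum_sub_distrib, Finset.sum_sub_distrib, ← Finset.mul_sum,
    ← Finset.mul_sum, ← Finset.mul_sum, ← Finset.mul_sum, hA b hb, hA c hc, hB] at h2
  have hrC : (Fintype.card F : ℂ) = (r : ℂ) ^ 2 := by exact_mod_cast hr
  have hr0 : (r : ℂ) ^ 2 ≠ 0 := by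
    rw [← hrC, hNc]
    exact_mod_cast Nat.succ_ne_zero N
  have hηC : (e : ℂ) * η = r - 1 := by exact_mod_cast hη
  have hfC : (f : ℂ) = η * (r + 1) := by
    have he : (e : ℂ) ≠ 0 := by
      have : e ≠ 0 := by rintro rfl; omega
      exact_mod_cast this
    apply mul_left_cancel₀ he
    have e1 : (e : ℂ) * f = N := by rw [hNf]; push_cast; ring
    have e2 : (N : ℂ) + 1 = r ^ 2 := by rw [← hrC, hNc]; push_cast; ring
    linear_combination e1 + e2 - (r + 1 : ℂ) * hηC
  rw [hrC, hfC] at h2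
  have h5 : (reps (cls f b) (cls f c) x : ℂ) = ((η ^ 2 + η * ((if x ∈ cls f b then 1 else 0) +
      (if x ∈ cls f c then 1 else 0)) +
      (if b ^ f = c ^ f then η - r * (if x ∈ cls f b then 1 else 0) else 0) : ℤ) : ℂ) := by
    apply mul_left_cancel₀ hr0
    rw [h2]
    push_cast
    split_ifs <;> ring
  exact_mod_cast h5

lemma exists_aux {θ : F} {q : ℕ} (hq : 2 ≤ q) (hθ : IsPrimitiveRoot θ ((q - 1) * (q + 1)))
    (hadd : ∀ x y : F, (x + y) ^ q = x ^ q + y ^ q) :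
    (θ ^ q) ^ q = θ ∧ θ + θ ^ q ≠ 0 ∧ (∃ ν : F, ν ^ (q + 1) = -1) ∧ ∃ t : F, t ^ (q - 1) = -1 := by
  have hpos : (q - 1) * (q + 1) ≠ 0 := mul_ne_zero (by omega) (by omega)
  have hθ0 : θ ≠ 0 := hθ.ne_zero hpos
  refine ⟨?_, ?_, ?_⟩
  · obtain ⟨s, rfl⟩ : ∃ s, q = s + 1 := ⟨q - 1, by omega⟩
    have h1 := hθ.pow_eq_one
    simp only [Nat.add_sub_cancel] at h1
    calc (θ ^ (s + 1)) ^ (s + 1) = θ * θ ^ (s * (s + 1 + 1)) := by ring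
      _ = θ := by rw [h1, mul_one]
  · intro h
    obtain ⟨s, rfl⟩ : ∃ s, q = s + 1 := ⟨q - 1, by omega⟩
    have h1 : θ * (1 + θ ^ s) = 0 := by rw [← h]; ring
    have h2 : θ ^ s = -1 := by
      have := (mul_eq_zero.1 h1).resolve_left hθ0
      linear_combination this
    have h3 : θ ^ (s * 2) = 1 := by rw [pow_mul, h2]; ring
    have h4 := (hθ.pow_eq_one_iff_dvd _).1 h3
    simp only [Nat.add_sub_cancel] at h4
    have h5 := Nat.dvd_of_mul_dvd_mul_left (by omega) h4
    have := Nat.le_of_dvd (by norm_num) h5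
    omega
  · rcases Nat.even_or_odd' q with ⟨k, hk | hk⟩
    · have h1 : (1 : F) = -1 := by
        have := hadd 1 (-1)
        rw [add_neg_cancel, zero_pow (by omega), one_pow, hk, pow_mul] at this
        norm_num at this
        rw [← sub_eq_zero]
        norm_num
        exact this.symm
      exact ⟨⟨1, by rw [one_pow]; exact h1⟩, ⟨1, by rw [one_pow]; exact h1⟩⟩
    · have h1 : θ ^ (k * (q + 1)) = -1 := by
        have h2 : (θ ^ (k * (q + 1))) ^ 2 = 1 := by
          rw [← pow_mul, ← hθ.pow_eq_one]
          congr 1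
          subst hk
          simp only [Nat.add_sub_cancel]
          ring
        rcases (sq_eq_sq_iff_eq_or_eq_neg.1 (h2.trans (one_pow 2).symm)) with h3 | h3
        · exfalso
          have h4 := (hθ.pow_eq_one_iff_dvd _).1 h3
          have h5 := Nat.dvd_of_mul_dvd_mul_right (by omega) h4
          have := Nat.le_of_dvd (by omega) h5
          omega
        · exact h3
      refine ⟨⟨θ ^ k, by rw [← pow_mul, h1]⟩, ⟨θ ^ (k + 1), ?_⟩⟩
      rw [← pow_mul, ← h1]
      congr 1
      subst hk
      simp only [Nat.add_sub_cancel]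
      ring

lemma cyclo_eq {α : F} {N : ℕ} (hα : IsPrimitiveRoot α N) (hN : 0 < N) {e f i : ℕ}
    (hNf : N = e * f) (hi : i < e) : cyclo α e f i = cls f (α ^ i) := by
  have h0 := hα.ne_zero hN.ne'
  apply Finset.eq_of_subset_of_card_le
  · intro x hx
    obtain ⟨j, hj, rfl⟩ := Finset.mem_image.1 hx
    rw [mem_cls, pow_add, mul_pow, ← pow_mul α (e * j), show e * j * f = N * j by rw [hNf]; ring,
      pow_mul α N, hα.pow_eq_one, one_pow, mul_one]
  · have h1 : (cls f (α ^ i)).card = f := card_pow_fiber hα hN hNf (pow_ne_zero _ h0)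
    rw [h1, cyclo, Finset.card_image_of_injOn, Finset.card_range]
    intro j hj k hk hjk
    simp only [Finset.coe_range, Set.mem_Iio] at hj hk
    have hlt : ∀ j, j < f → i + e * j < N := by
      intro j hj
      rw [hNf]
      calc i + e * j < e + e * j := by omega
        _ = e * (j + 1) := by ring
        _ ≤ e * f := Nat.mul_le_mul_left _ hj
    have := hα.pow_inj (hlt j hj) (hlt k hk) hjk
    have h3 : e * j = e * k := by omega
    exact Nat.eq_of_mul_eq_mul_left (by omega) h3

lemma count_ext (A B : Finset F) (x : F) : ((extDiff A B).count x : ℤ) = reps A B x := by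
  unfold extDiff reps
  rw [Multiset.count_map, ← Finset.sum_product']
  rw [← Finset.filter_val, Finset.card_val, Finset.card_filter]
  push_cast
  refine Finset.sum_congr rfl fun p _ => ?_
  simp only [eq_comm]

lemma count_int (A : Finset F) (x : F) :
    ((intDiff A).count x : ℤ) = if x = 0 then 0 else reps A A x := by
  unfold intDiff reps
  rw [Multiset.count_map, ← Finset.sum_product']
  rw [← Finset.filter_val, Finset.card_val, Finset.filter_filter, Finset.card_filter]
  push_cast
  split_ifs with h
  · apply Finset.sum_eq_zero
    intro p _
    rw [if_neg]
    rintro ⟨h1, h2⟩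
    rw [h] at h2
    exact h1 (sub_eq_zero.1 h2.symm)
  · refine Finset.sum_congr rfl fun p _ => ?_
    congr 1
    apply propext
    constructor
    · exact fun h => h.2.symm
    · intro h1
      refine ⟨?_, h1.symm⟩
      intro h2
      apply h
      rw [← h1, h2, sub_self]

lemma reps_zero {A B : Finset F} (h : Disjoint A B) : reps A B 0 = 0 := by
  unfold reps
  apply Finset.sum_eq_zero
  intro y hy
  apply Finset.sum_eq_zero
  intro z hz
  rw [if_neg]
  intro h1
  exact Finset.disjoint_left.1 h hy (sub_eq_zero.1 h1 ▸ hz)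

/-- the combinatorial core -/
lemma core {α : F} {q beta e f : ℕ} {eta : ℤ}
    (hq : IsPrimePow q) (hbeta : 0 < beta)
    (hcard : Fintype.card F = q ^ (2 * beta))
    (he : 3 ≤ e) (hdvd : e ∣ q + 1)
    (hfe : e * f = q ^ (2 * beta) - 1) (hf : 1 < f)
    (heta : (e : ℤ) * eta = (-(q : ℤ)) ^ beta - 1)
    (hp : IsPrimitiveElt α) :
    (∀ i < e, (cyclo α e f i).card = f ∧ (0 : F) ∉ cyclo α e f i) ∧
    (∀ i < e, ∀ j < e, i ≠ j → Disjoint (cyclo α e f i) (cyclo α e f j)) ∧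
    ∀ i < e, ∀ j < e, ∀ x : F, x ≠ 0 → reps (cyclo α e f i) (cyclo α e f j) x =
      eta ^ 2 + eta * ((if x ∈ cyclo α e f i then 1 else 0) +
      (if x ∈ cyclo α e f j then 1 else 0)) +
      (if i = j then eta - (e * eta + 1) * (if x ∈ cyclo α e f i then 1 else 0) else 0) := by
  obtain ⟨hadd, ψ, hψ, hψq⟩ := exists_psi q (2 * beta) hq hcard
  have hq2 : 2 ≤ q := hq.two_le
  set N := e * f with hNf
  have hN : 0 < N := by positivity
  have hNc : Fintype.card F = N + 1 := by
    rw [hcard]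
    have : 0 < q ^ (2 * beta) := by positivity
    omega
  have h6 : 6 ≤ N := by rw [hNf]; nlinarith
  have hα : IsPrimitiveRoot α N := by
    have := ord_alpha α hp (by omega)
    rwa [hNc, Nat.add_sub_cancel] at this
  have h0 : α ≠ 0 := hα.ne_zero hN.ne'
  obtain ⟨M, hM⟩ : ∃ M, N = (q - 1) * (q + 1) * M := by
    have h1 : q ^ 2 - 1 ∣ (q ^ 2) ^ beta - 1 ^ beta := Nat.sub_dvd_pow_sub_pow _ _ _
    rw [one_pow, ← pow_mul, ← hfe] at h1
    obtain ⟨M, hM⟩ := h1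
    refine ⟨M, ?_⟩
    rw [hM]
    congr 1
    rw [mul_comm, ← Nat.sq_sub_sq, one_pow]
  obtain ⟨m, hm⟩ := hdvd
  have hfm : f = (q - 1) * M * m := by
    apply Nat.eq_of_mul_eq_mul_left (show 0 < e by omega)
    rw [← hNf, hM, hm]; ring
  have hθ : IsPrimitiveRoot (α ^ M) ((q - 1) * (q + 1)) := hα.pow hN (by rw [hM]; ring)
  obtain ⟨hθ1, hθ2, ⟨ν, hν⟩, ⟨t, ht⟩⟩ := exists_aux hq2 hθ hadd
  have hν0 : ν ≠ 0 := by
    rintro rfl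
    simp at hν
  have ht0 : t ≠ 0 := by
    rintro rfl
    rw [zero_pow (by omega)] at ht
    simp at ht
  have hneg : (-1 : F) ^ f = 1 := by
    have := FiniteField.pow_card_sub_one_eq_one ν hν0
    rw [hNc, Nat.add_sub_cancel] at this
    rw [← hν, ← pow_mul, hm, show e * m * f = N * m by rw [hNf]; ring, pow_mul, this, one_pow]
  have hS := fun (a : F) (ha : a ≠ 0) =>
    S_val hp hα hN hNc hq2 hcard hM hψ hadd hψq hν hθ1 hθ2 ht ha
  have hP := fun (a b : F) (ha : a ≠ 0) (hb : b ≠ 0) =>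
    period hα hN hNc (n := (q - 1) * M) (by rw [hM]; ring) hfm hm heta ht0 hS ha hb
  have hr : (Fintype.card F : ℤ) = ((-(q : ℤ)) ^ beta) ^ 2 := by
    rw [hcard]
    push_cast
    rw [← pow_mul, mul_comm beta 2, pow_mul, pow_mul, neg_sq]
  have hinj : ∀ i < e, ∀ j < e, (α ^ i) ^ f = (α ^ j) ^ f → i = j := by
    intro i hi j hj hij
    rw [← pow_mul, ← pow_mul] at hij
    have := hα.pow_inj (by rw [hNf]; exact Nat.mul_lt_mul_of_pos_right hi (by omega))
      (by rw [hNf]; exact Nat.mul_lt_mul_of_pos_right hj (by omega)) hij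
    exact Nat.eq_of_mul_eq_mul_right (by omega) this
  refine ⟨?_, ?_, ?_⟩
  · intro i hi
    rw [cyclo_eq hα hN hNf hi]
    refine ⟨card_pow_fiber hα hN hNf (pow_ne_zero _ h0), ?_⟩
    rw [mem_cls, zero_pow (by omega)]
    exact (pow_ne_zero _ (pow_ne_zero _ h0)).symm
  · intro i hi j hj hij
    rw [cyclo_eq hα hN hNf hi, cyclo_eq hα hN hNf hj, Finset.disjoint_left]
    intro x hx hx'
    rw [mem_cls] at hx hx'
    exact hij (hinj i hi j hj (hx.symm.trans hx'))
  · intro i hi j hj x hx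
    rw [cyclo_eq hα hN hNf hi, cyclo_eq hα hN hNf hj,
      reps_cls hα hN hNc hψ hNf hneg heta hr ht0 hP (pow_ne_zero _ h0) (pow_ne_zero _ h0) hx]
    have e1 : (α ^ i) ^ f = (α ^ j) ^ f ↔ i = j := ⟨hinj i hi j hj, fun h => by rw [h]⟩
    simp only [e1]
    rw [show (e : ℤ) * eta + 1 = (-(q : ℤ)) ^ beta by linear_combination heta]

lemma sum_ind {C : ℕ → Finset F} {I : Finset ℕ}
    (hd : ∀ i ∈ I, ∀ j ∈ I, i ≠ j → Disjoint (C i) (C j)) (x : F) :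
    ∑ i ∈ I, (if x ∈ C i then (1 : ℤ) else 0) = if x ∈ I.biUnion C then 1 else 0 := by
  split_ifs with h
  · obtain ⟨i, hi, hx⟩ := Finset.mem_biUnion.1 h
    rw [Finset.sum_eq_single_of_mem i hi, if_pos hx]
    intro j hj hji
    rw [if_neg]
    exact fun hx' => Finset.disjoint_left.1 (hd j hj i hi hji) hx' hx
  · apply Finset.sum_eq_zero
    intro i hi
    rw [if_neg]
    exact fun hx => h (Finset.mem_biUnion.2 ⟨i, hi, hx⟩)

lemma reps_biUnion {C : ℕ → Finset F} {I : Finset ℕ}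
    (hd : ∀ i ∈ I, ∀ j ∈ I, i ≠ j → Disjoint (C i) (C j)) (x : F) :
    reps (I.biUnion C) (I.biUnion C) x = ∑ i ∈ I, ∑ j ∈ I, reps (C i) (C j) x := by
  have hd' : Set.PairwiseDisjoint (I : Set ℕ) C := fun i hi j hj hij => hd i hi j hj hij
  unfold reps
  rw [Finset.sum_biUnion hd']
  refine Finset.sum_congr rfl fun i _ => ?_
  simp_rw [Finset.sum_biUnion hd']
  rw [Finset.sum_comm]

end Helpers

/-- Theorem (uniform cyclotomy): let `q′ = q^{2β}`, `e ≥ 3` with `e ∣ q+1`,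
`η = ((-q)^β - 1)/e` and `f = (q′-1)/e`.  Then (i) each `C_i^e` is a
`(q′, f, η²-(e-3)η-1, η²+η)`-PDS; (ii) any family of `u` distinct classes (`2 ≤ u ≤ e-1`)
is a `(q′,u,f,uη²+(u+2-e)η-1,u(η²+η))`-DPDF and a `(q′,u,f,u(u-1)η²+2(u-1)η,u(u-1)η²)`-EPDF;
(iii) the union of the `u` classes is a `(q′,uf,u²η²+(3u-e)η-1,u²η²+uη)`-PDS, proper except
when `η = 1 = 2u-e` or `η = -1 = 2u-e`. -/
theorem uniform_cyclotomy_pds_dpdf_epdf {F : Type*} [Field F] [Fintype F] [DecidableEq F]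
    (q beta e u f : ℕ) (eta : ℤ) (α : F) (I : Finset ℕ)
    (hq : IsPrimePow q) (hbeta : 0 < beta)
    (hcard : Fintype.card F = q ^ (2 * beta))
    (he : 3 ≤ e) (hdvd : e ∣ q + 1)
    (hfe : e * f = q ^ (2 * beta) - 1) (hf : 1 < f)
    (heta : (e : ℤ) * eta = (-(q : ℤ)) ^ beta - 1)
    (hα : IsPrimitiveElt α)
    (hI : I ⊆ Finset.range e) (hIcard : I.card = u) (hu2 : 2 ≤ u) (hue : u ≤ e - 1) :
    (∀ i < e, IsPDS (q ^ (2 * beta)) f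
        (eta ^ 2 - ((e : ℤ) - 3) * eta - 1) (eta ^ 2 + eta) (cyclo α e f i)) ∧
    (IsDPDF (q ^ (2 * beta)) u f
        ((u : ℤ) * eta ^ 2 + ((u : ℤ) + 2 - (e : ℤ)) * eta - 1)
        ((u : ℤ) * (eta ^ 2 + eta))
        (fun i : ↥I => cyclo α e f (i : ℕ)) ∧
     IsEPDF (q ^ (2 * beta)) u f
        ((u : ℤ) * ((u : ℤ) - 1) * eta ^ 2 + 2 * ((u : ℤ) - 1) * eta)
        ((u : ℤ) * ((u : ℤ) - 1) * eta ^ 2)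
        (fun i : ↥I => cyclo α e f (i : ℕ))) ∧
    (IsPDS (q ^ (2 * beta)) (u * f)
        ((u : ℤ) ^ 2 * eta ^ 2 + (3 * (u : ℤ) - (e : ℤ)) * eta - 1)
        ((u : ℤ) ^ 2 * eta ^ 2 + (u : ℤ) * eta)
        (I.biUnion fun i => cyclo α e f i) ∧
     (¬ ((eta = 1 ∧ 2 * (u : ℤ) - (e : ℤ) = 1) ∨ (eta = -1 ∧ 2 * (u : ℤ) - (e : ℤ) = -1)) →
        (u : ℤ) ^ 2 * eta ^ 2 + (3 * (u : ℤ) - (e : ℤ)) * eta - 1 ≠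
          (u : ℤ) ^ 2 * eta ^ 2 + (u : ℤ) * eta)) := by
  obtain ⟨hA, hD, hR⟩ := core hq hbeta hcard he hdvd hfe hf heta hα
  set C := cyclo α e f with hC
  have hIe : ∀ i ∈ I, i < e := fun i hi => Finset.mem_range.1 (hI hi)
  have hDI : ∀ i ∈ I, ∀ j ∈ I, i ≠ j → Disjoint (C i) (C j) :=
    fun i hi j hj => hD i (hIe i hi) j (hIe j hj)
  have hU0 : (0 : F) ∉ I.biUnion C := by
    intro h
    obtain ⟨i, hi, hx⟩ := Finset.mem_biUnion.1 h
    exact (hA i (hIe i hi)).2 hx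
  have hfam : famU (fun i : ↥I => C (i : ℕ)) = I.biUnion C := by
    ext x
    simp [famU]
  have hshape : FamShape (q ^ (2 * beta)) u f (fun i : ↥I => C (i : ℕ)) := by
    refine ⟨hcard, by simp [hIcard], fun i => (hA i (hIe i i.2)).1, ?_⟩
    intro i j hij
    exact hDI i i.2 j j.2 (fun h => hij (Subtype.ext h))
  have hz : ∀ i : ↥I, (0 : F) ∉ C (i : ℕ) := fun i => (hA i (hIe i i.2)).2
  have hint : ∀ x : F, x ≠ 0 → ∑ i ∈ I, reps (C i) (C i) x
      = u * (eta ^ 2 + eta) + ((2 - e) * eta - 1) * if x ∈ I.biUnion C then 1 else 0 := by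
    intro x hx
    rw [← sum_ind hDI, Finset.mul_sum, ← hIcard, ← nsmul_eq_mul, ← Finset.sum_const,
      ← Finset.sum_add_distrib]
    refine Finset.sum_congr rfl fun i hi => ?_
    rw [hR i (hIe i hi) i (hIe i hi) x hx, if_pos rfl]
    ring
  have hall : ∀ x : F, x ≠ 0 → ∑ i ∈ I, ∑ j ∈ I, reps (C i) (C j) x
      = u ^ 2 * eta ^ 2 + u * eta + ((2 * u - e) * eta - 1) * if x ∈ I.biUnion C then 1 else 0 := by
    intro x hx
    have h1 : ∀ i ∈ I, ∑ j ∈ I, reps (C i) (C j) x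
        = u * eta ^ 2 + u * eta * (if x ∈ C i then 1 else 0)
          + eta * (if x ∈ I.biUnion C then 1 else 0)
          + (eta - (e * eta + 1) * (if x ∈ C i then 1 else 0)) := by
      intro i hi
      rw [Finset.sum_congr rfl (fun j hj => hR i (hIe i hi) j (hIe j hj) x hx),
        Finset.sum_add_distrib, Finset.sum_add_distrib, ← Finset.mul_sum,
        Finset.sum_add_distrib, sum_ind hDI, Finset.sum_ite_eq, if_pos hi]
      simp only [Finset.sum_const, hIcard, nsmul_eq_mul]
      ring
    rw [Finset.sum_congr rfl h1]
    simp only [Finset.sum_add_distrib, Finset.sum_sub_distrib, ← Finset.mul_sum, sum_ind hDI,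
      Finset.sum_const, hIcard, nsmul_eq_mul]
    ring
  refine ⟨?_, ⟨⟨hshape, hz, ?_⟩, ⟨hshape, hz, ?_⟩⟩, ⟨⟨hcard, ?_, ?_⟩, ?_⟩⟩
  · intro i hi
    refine ⟨hcard, (hA i hi).1, ?_⟩
    intro x
    rw [count_int]
    by_cases hx : x = 0
    · subst hx
      rw [if_pos rfl, if_neg (hA i hi).2, if_pos rfl]
    · rw [if_neg hx, if_neg hx, hR i hi i hi x hx, if_pos rfl]
      split_ifs <;> ring
  · intro x
    rw [hfam]
    have h1 : ((famInt (fun i : ↥I => C (i : ℕ))).count x : ℤ)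
        = ∑ i ∈ I, ((intDiff (C i)).count x : ℤ) := by
      unfold famInt
      rw [Multiset.count_sum']
      push_cast
      exact Finset.sum_coe_sort I (fun i => ((intDiff (C i)).count x : ℤ))
    rw [h1]
    simp only [count_int]
    by_cases hx : x = 0
    · subst hx
      simp [hU0]
    · simp only [if_neg hx]
      rw [hint x hx]
      split_ifs <;> ring
  · intro x
    rw [hfam]
    have h1 : ((famExt (fun i : ↥I => C (i : ℕ))).count x : ℤ)
        = ∑ i ∈ I, ∑ j ∈ I, if j = i then 0 else reps (C i) (C j) x := by
      unfold famExt
      rw [Multiset.count_sum']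
      push_cast
      rw [← Finset.sum_coe_sort I]
      refine Finset.sum_congr rfl fun i _ => ?_
      rw [Multiset.count_sum']
      push_cast
      rw [← Finset.sum_coe_sort I]
      refine Finset.sum_congr rfl fun j _ => ?_
      by_cases hij : j = i
      · simp [hij]
      · have : (j : ℕ) ≠ i := fun h => hij (Subtype.ext h)
        rw [if_neg hij, if_neg this, count_ext]
    rw [h1]
    by_cases hx : x = 0
    · subst hx
      rw [if_neg hU0, if_pos rfl]
      refine Finset.sum_eq_zero fun i hi => Finset.sum_eq_zero fun j hj => ?_
      split_ifs with h
      · rfl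
      · exact reps_zero (hDI i hi j hj (Ne.symm h))
    · have h2 : ∑ i ∈ I, ∑ j ∈ I, (if j = i then 0 else reps (C i) (C j) x)
          = ∑ i ∈ I, ∑ j ∈ I, reps (C i) (C j) x - ∑ i ∈ I, reps (C i) (C i) x := by
        rw [← Finset.sum_sub_distrib]
        refine Finset.sum_congr rfl fun i hi => ?_
        rw [eq_sub_iff_add_eq]
        have h3 : reps (C i) (C i) x = ∑ j ∈ I, if j = i then reps (C i) (C j) x else 0 := by
          rw [Finset.sum_ite_eq', if_pos hi]
        rw [h3, ← Finset.sum_add_distrib]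
        refine Finset.sum_congr rfl fun j _ => ?_
        split_ifs <;> simp
      rw [h2, hall x hx, hint x hx, if_neg hx]
      split_ifs <;> ring
  · rw [Finset.card_biUnion hDI, Finset.sum_congr rfl (fun i hi => (hA i (hIe i hi)).1),
      Finset.sum_const, hIcard, smul_eq_mul]
  · intro x
    rw [count_int]
    by_cases hx : x = 0
    · subst hx
      rw [if_pos rfl, if_neg hU0, if_pos rfl]
    · rw [if_neg hx, if_neg hx, reps_biUnion hDI, hall x hx]
      split_ifs <;> ring
  · intro hne heq
    apply hne
    have h1 : eta * (2 * (u : ℤ) - e) = 1 := by linear_combination heq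
    rcases Int.mul_eq_one_iff_eq_one_or_neg_one.1 h1 with h | h
    · exact Or.inl h
    · exact Or.inr h
end

section
/- Let GF(q′) be a finite field of order q′ = q^{2β} where q is a prime power and β is a positive integer. Let e ≥ 3 divide q + 1 and set η = ((−q)^β − 1)/e. Let u, w be positive integers with wu ≤ e, let I₁, …, I_w be pairwise disjoint subsets of {0, 1, …, e−1} each of size u, let D_a = ⋃_{i ∈ I_a} C_i^e, and let W′ = {D₁, …, D_w}. Then: (i) W′ is a (q′, w, u(q′−1)/e, u²η² + (3u−e)η − 1 + (w−1)(u²η² + uη), w(u²η² + uη))-disjoint partial difference family; (ii) when w ≥ 2, W′ is a (q′, w, u(q′−1)/e, w(w−1)u²η² + 2(w−1)uη, w(w−1)u²η²)-external partial difference family; (iii) if ⋃_a D_a ≠ GF(q′)* (i.e. wu < e), then W′ is a disjoint difference family if and only if each D_a is a difference set; (iv) when w ≥ 2, if ⋃_a D_a ≠ GF(q′)*, then W′ is not an external difference family. -/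
open Finset

section Helpers

variable {F : Type*} [Field F] [Fintype F] [DecidableEq F]

lemma ucd_exists_psi (q beta : ℕ) (hq : IsPrimePow q) (hcard : Fintype.card F = q ^ (2 * beta)) :
    ∃ ψ : AddChar F ℂ,
      (∀ a : F, ∑ x, ψ (x * a) = if a = 0 then (Fintype.card F : ℂ) else 0) ∧
      (∀ x, ψ (x ^ q) = ψ x) ∧ (∀ x y : F, (x + y) ^ q = x ^ q + y ^ q) ∧
      (∀ x, IsIntegral ℤ (ψ x)) := by
  obtain ⟨p, n, hp, hn, rfl⟩ := hq
  have hp' : p.Prime := hp.nat_prime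
  have : Fact p.Prime := ⟨hp'⟩
  rw [← pow_mul] at hcard
  have hch : CharP F p := charP_of_card_eq_prime_pow hcard
  let : Algebra (ZMod p) F := ZMod.algebra F p
  let ψ : AddChar F ℂ := AddChar.compAddMonoidHom (ZMod.stdAddChar (N := p))
    (Algebra.trace (ZMod p) F).toAddMonoidHom
  have hψ : ∀ x, ψ x = ZMod.stdAddChar (N := p) (Algebra.trace (ZMod p) F x) := fun x => rfl
  refine ⟨ψ, ?_, ?_, ?_, ?_⟩
  · intro a
    have hprim : ψ.IsPrimitive := by
      apply AddChar.IsPrimitive.of_ne_one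
      intro h1
      have htr := (traceForm_nondegenerate (ZMod p) F).1 1
      simp_rw [Algebra.traceForm_apply] at htr
      refine one_ne_zero (htr fun b => ?_)
      have : ψ (1 * b) = 1 := by rw [h1]; rfl
      rw [hψ] at this
      apply ZMod.injective_stdAddChar (N := p)
      rw [this, AddChar.map_zero_eq_one]
    rw [AddChar.sum_mulShift a hprim]
    split_ifs <;> simp
  · have h1 : ∀ x, ψ (x ^ p) = ψ x := by
      intro x
      rw [hψ, hψ, ← Algebra.trace_eq_of_algEquiv
        (FiniteField.frobeniusAlgEquivOfAlgebraic (ZMod p) F) x]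
      simp
    intro x
    clear hn hcard
    induction n with
    | zero => simp
    | succ n ih => rw [pow_succ, pow_mul, h1, ih]
  · intro x y
    exact add_pow_char_pow x y p n
  · intro x
    apply IsIntegral.of_pow hp'.pos
    rw [← AddChar.map_nsmul_eq_pow]
    have : p • x = 0 := by simp
    rw [this, AddChar.map_zero_eq_one]
    exact isIntegral_one

lemma ucd_prim (α : F) (hα : IsPrimitiveElt α) (h3 : 3 ≤ Fintype.card F) :
    α ≠ 0 ∧ IsPrimitiveRoot α (Fintype.card F - 1) := by
  have h0 : α ≠ 0 := by
    rintro rfl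
    have : (Finset.univ : Finset F) ⊆ {0, 1} := by
      intro x _
      by_cases hx : x = 0
      · simp [hx]
      · obtain ⟨k, hk⟩ := hα x hx
        rcases Nat.eq_zero_or_pos k with rfl | hk'
        · simp [hk]
        · rw [zero_pow hk'.ne'] at hk
          exact absurd hk hx
    have := Finset.card_le_card this
    rw [Finset.card_univ] at this
    have h2 : ({0, 1} : Finset F).card ≤ 2 := Finset.card_le_two
    omega
  refine ⟨h0, ?_⟩
  have h1 : orderOf (Units.mk0 α h0) = Nat.card Fˣ := by
    apply orderOf_eq_card_of_forall_mem_zpowers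
    intro x
    obtain ⟨k, hk⟩ := hα x x.ne_zero
    refine ⟨k, ?_⟩
    ext
    simp [hk]
  rw [Nat.card_eq_fintype_card, Fintype.card_units] at h1
  rw [← h1, ← orderOf_units]
  exact IsPrimitiveRoot.orderOf _

lemma ucd_exists_root (α : F) (hα : IsPrimitiveElt α)
    (hp : IsPrimitiveRoot α (Fintype.card F - 1)) (d k : ℕ) (hd : d * k = Fintype.card F - 1)
    (hk : 0 < k) (x : F) (hx : x ≠ 0) (hxk : x ^ k = 1) : ∃ j : ℕ, x = α ^ (d * j) := by
  obtain ⟨j, rfl⟩ := hα x hx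
  rw [← pow_mul] at hxk
  have := hp.dvd_of_pow_eq_one _ hxk
  rw [← hd] at this
  obtain ⟨t, rfl⟩ := Nat.dvd_of_mul_dvd_mul_right hk this
  exact ⟨t, rfl⟩

lemma ucd_card_roots (α : F) (hp : IsPrimitiveRoot α (Fintype.card F - 1)) (d k : ℕ)
    (hd : d * k = Fintype.card F - 1) (hc : 0 < Fintype.card F - 1) (c : F) (h0 : c ≠ 0) :
    (Finset.univ.filter fun x : F => x ^ d = c ^ d).card = d := by
  have hpr : IsPrimitiveRoot (α ^ k) d := hp.pow hc (by rw [← hd, mul_comm])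
  have hdpos : 0 < d := Nat.pos_of_ne_zero (by rintro rfl; simp at hd; omega)
  have h1 := hpr.card_nthRoots (c ^ d)
  rw [if_pos ⟨c, rfl⟩] at h1
  have h2 := hpr.nthRoots_nodup (pow_ne_zero d h0)
  rw [← Multiset.toFinset_card_of_nodup h2] at h1
  refine Eq.trans (congrArg Finset.card ?_) h1
  ext x
  simp [Polynomial.mem_nthRoots hdpos]

lemma ucd_mem_cyclo (α : F) (hα : IsPrimitiveElt α) (h0 : α ≠ 0)
    (hp : IsPrimitiveRoot α (Fintype.card F - 1)) (e f : ℕ) (hef : e * f = Fintype.card F - 1)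
    (hf : 0 < f) (i : ℕ) (x : F) : x ∈ cyclo α e f i ↔ x ^ f = (α ^ i) ^ f := by
  unfold cyclo
  rw [Finset.mem_image]
  constructor
  · rintro ⟨j, -, rfl⟩
    rw [pow_add, mul_pow, ← pow_mul α (e * j), mul_right_comm, hef, pow_mul, hp.pow_eq_one,
      one_pow, mul_one]
  · intro h
    have hai : α ^ i ≠ 0 := pow_ne_zero _ h0
    have hx : x ≠ 0 := by
      rintro rfl
      rw [zero_pow hf.ne'] at h
      exact pow_ne_zero f hai h.symm
    obtain ⟨j, hj⟩ := ucd_exists_root α hα hp e f hef hf (x / α ^ i) (div_ne_zero hx hai)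
      (by rw [div_pow, h, div_self (pow_ne_zero f hai)])
    refine ⟨j % f, Finset.mem_range.2 (Nat.mod_lt _ hf), ?_⟩
    rw [div_eq_iff hai] at hj
    rw [hj, pow_add, mul_comm]
    congr 1
    conv_rhs => rw [← Nat.mod_add_div j f, mul_add, ← mul_assoc, hef, pow_add, pow_mul α (_ - 1),
      hp.pow_eq_one, one_pow, mul_one]

lemma ucd_sign (q k : ℕ) (hq : 2 ≤ q) (s : ℂ) (T : ℂ) (hT : IsIntegral ℤ T)
    (hs : s = 1 + (q + 1) * T) (hs2 : s * s = ((q : ℂ) ^ k) ^ 2) : s = (((-(q : ℤ)) ^ k : ℤ) : ℂ) := by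
  have hmod : ((q : ℤ) + 1) ∣ (-(q : ℤ)) ^ k - 1 := by
    have h : (-(q : ℤ)) - 1 ∣ (-(q : ℤ)) ^ k - 1 ^ k := sub_dvd_pow_sub_pow _ _ _
    rw [one_pow] at h
    have h2 : (-(q : ℤ)) - 1 = -((q : ℤ) + 1) := by ring
    rw [h2, neg_dvd] at h
    exact h
  have hq1 : ((q : ℂ) + 1) ≠ 0 := by exact_mod_cast Nat.succ_ne_zero q
  have hcases : s = (((-(q : ℤ)) ^ k : ℤ) : ℂ) ∨ s = ((-(-(q : ℤ)) ^ k : ℤ) : ℂ) := by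
    have : s * s = ((((-(q : ℤ)) ^ k : ℤ) : ℂ)) * ((((-(q : ℤ)) ^ k : ℤ) : ℂ)) := by
      rw [hs2]
      push_cast
      rw [← mul_pow, ← pow_mul, mul_comm k 2, pow_mul]
      congr 1
      ring
    rcases mul_self_eq_mul_self_iff.1 this with h | h
    · exact Or.inl h
    · right; rw [h]; push_cast; rfl
  rcases hcases with h | h
  · exact h
  · exfalso
    obtain ⟨m, hm⟩ := hmod
    -- T is rational
    have hTq : T = algebraMap ℚ ℂ (((-(-(q : ℤ)) ^ k : ℤ) - 1 : ℚ) / ((q : ℚ) + 1)) := by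
      have : T = (s - 1) / (q + 1) := by rw [hs]; field_simp; ring
      rw [this, h]
      push_cast
      simp
    rw [hTq] at hT
    have hT2 := (isIntegral_algebraMap_iff (algebraMap ℚ ℂ).injective).1 hT
    obtain ⟨n, hn⟩ := IsIntegrallyClosed.isIntegral_iff.1 hT2
    have hq2 : ((q : ℚ) + 1) ≠ 0 := by exact_mod_cast Nat.succ_ne_zero q
    rw [eq_div_iff hq2] at hn
    have hn' : n * ((q : ℤ) + 1) = (-(-(q : ℤ)) ^ k) - 1 := by
      have h3 : ((n * ((q : ℤ) + 1) : ℤ) : ℚ) = (((-(-(q : ℤ)) ^ k) - 1 : ℤ) : ℚ) := by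
        push_cast
        push_cast at hn
        simpa using hn
      exact_mod_cast h3
    have hd : ((q : ℤ) + 1) ∣ 2 := ⟨-(m + n), by linarith⟩
    have := Int.le_of_dvd (by norm_num) hd
    omega

lemma ucd_neg_pow (q : ℕ) (hq : 2 ≤ q) (hadd : ∀ x y : F, (x + y) ^ q = x ^ q + y ^ q) (x : F) :
    (-x) ^ q = -(x ^ q) := by
  have := hadd (-x) x
  rw [neg_add_cancel, zero_pow (by omega)] at this
  exact eq_neg_of_add_eq_zero_left this.symm

lemma ucd_pow_inj (q : ℕ) (hq : 2 ≤ q) (hadd : ∀ x y : F, (x + y) ^ q = x ^ q + y ^ q) :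
    Function.Bijective (fun x : F => x ^ q) := by
  rw [← Finite.injective_iff_bijective]
  intro x y h
  have h1 := hadd x (-y)
  rw [ucd_neg_pow q hq hadd] at h1
  have h2 : x ^ q = y ^ q := h
  rw [h2, add_neg_cancel] at h1
  have := pow_eq_zero_iff (n := q) (by omega) |>.1 h1
  exact eq_of_sub_eq_zero (by rw [sub_eq_add_neg]; exact this)

/-- arithmetic: `q^2 - 1 ∣ q^(2β) - 1`. -/
lemma ucd_arith (q beta : ℕ) (hq : 2 ≤ q) (hb : 0 < beta) : ∃ K, 0 < K ∧
    (q ^ 2 - 1) * K = q ^ (2 * beta) - 1 := by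
  obtain ⟨K, hK⟩ := Nat.sub_one_dvd_pow_sub_one (q ^ 2) beta
  refine ⟨K, Nat.pos_of_ne_zero ?_, ?_⟩
  · rintro rfl
    have : 1 < (q ^ 2) ^ beta := Nat.one_lt_pow hb.ne' (Nat.one_lt_pow (by norm_num) (by omega))
    omega
  · rw [pow_mul, hK]

lemma ucd_b0 (q K : ℕ) (hq : 2 ≤ q) (hK0 : 0 < K) (hK : (q ^ 2 - 1) * K = Fintype.card F - 1)
    (hadd : ∀ x y : F, (x + y) ^ q = x ^ q + y ^ q) (α : F) (h0 : α ≠ 0)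
    (hp : IsPrimitiveRoot α (Fintype.card F - 1)) :
    ∃ b0 c : F, b0 ≠ 0 ∧ b0 ^ q = -b0 ∧ c + c ^ q = 1 := by
  have hq2 : 2 * (q - 1) < q ^ 2 - 1 := by
    obtain ⟨r, rfl⟩ := Nat.exists_eq_add_of_le hq
    have : (2 + r) ^ 2 = 4 + 4 * r + r * r := by ring
    have h2 : 0 ≤ r * r := Nat.zero_le _
    omega
  have hg : IsPrimitiveRoot (α ^ K) (q ^ 2 - 1) :=
    hp.pow (by rw [← hK]; apply Nat.mul_pos <;> omega) (by rw [← hK, mul_comm])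
  set g := α ^ K with hgdef
  have hg0 : g ≠ 0 := pow_ne_zero _ h0
  have hgqq : (g ^ q) ^ q = g := by
    rw [← pow_mul, ← pow_two]
    have : q ^ 2 = (q ^ 2 - 1) + 1 := by omega
    rw [this, pow_succ, hg.pow_eq_one, one_mul]
  have hgq : g ^ (2 * (q - 1)) ≠ 1 := hg.pow_ne_one_of_pos_of_lt (by omega) hq2
  have hsucc : ∀ x : F, x ^ q = x ^ (q - 1) * x := by
    intro x
    rw [← pow_succ]; congr 1; omega
  have hsq : (g ^ q) ^ 2 ≠ g ^ 2 := by
    intro h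
    apply hgq
    rw [hsucc, mul_pow] at h
    have := mul_right_cancel₀ (pow_ne_zero 2 hg0) (h.trans (one_mul _).symm)
    rw [mul_comm, pow_mul]; exact this
  have hs : g + g ^ q ≠ 0 := by
    intro h
    apply hsq
    rw [eq_neg_of_add_eq_zero_right h]; ring
  have hdiff : g - g ^ q ≠ 0 := by
    intro h
    apply hsq
    rw [← sub_eq_zero.1 h]
  refine ⟨g - g ^ q, g / (g + g ^ q), hdiff, ?_, ?_⟩
  · rw [sub_eq_add_neg, hadd, ucd_neg_pow q hq hadd, hgqq]; ring
  · rw [div_pow, hadd, hgqq, add_comm (g ^ q) g, ← add_div, div_self hs]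

lemma ucd_S_neg (q M : ℕ) (ψ : AddChar F ℂ) (hM0 : 0 < M) (hM : (q + 1) * M = Fintype.card F - 1)
    (α : F) (hα : IsPrimitiveElt α) (hp : IsPrimitiveRoot α (Fintype.card F - 1))
    (hneg : (-1 : F) ^ M = 1) (a : F) :
    ∑ x, ψ (-a * x ^ (q + 1)) = ∑ x, ψ (a * x ^ (q + 1)) := by
  obtain ⟨j, hj⟩ := ucd_exists_root α hα hp (q + 1) M hM hM0 (-1) (by simp) hneg
  have hw : (α ^ j) ≠ 0 := by
    intro h
    rw [mul_comm, pow_mul, h, zero_pow (by omega)] at hj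
    simp at hj
  rw [← Equiv.sum_comp (Equiv.mulLeft₀ (α ^ j) hw)]
  apply Finset.sum_congr rfl
  intro x _
  congr 1
  change -a * (α ^ j * x) ^ (q + 1) = _
  rw [mul_pow, ← pow_mul, mul_comm j, ← hj]
  ring

lemma ucd_rad (q M : ℕ) (hq : 2 ≤ q) (hM0 : 0 < M) (hM : (q + 1) * M = Fintype.card F - 1)
    (hqM : q - 1 ∣ M)
    (hadd : ∀ x y : F, (x + y) ^ q = x ^ q + y ^ q) (α : F) (hα : IsPrimitiveElt α)
    (hp : IsPrimitiveRoot α (Fintype.card F - 1)) (b0 : F) (hb : b0 ≠ 0) (hbq : b0 ^ q = - b0)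
    (a : F) (ha : a ≠ 0) :
    (Finset.univ.filter fun z : F => a * z + a ^ q * (z ^ q) ^ q = 0).card
      = if a ^ M = b0 ^ M then q ^ 2 else 1 := by
  have hc : 0 < Fintype.card F - 1 := by rw [← hM]; positivity
  have hsucc : ∀ x : F, x ^ q = x ^ (q - 1) * x := by
    intro x
    rw [← pow_succ]; congr 1; omega
  have hq2 : 1 < q ^ 2 := Nat.one_lt_pow (by norm_num) (by omega)
  have hsucc2 : ∀ x : F, (x ^ q) ^ q = x ^ (q ^ 2 - 1) * x := by
    intro x
    rw [← pow_succ, ← pow_mul, ← pow_two]; congr 1; omega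
  split_ifs with h
  · obtain ⟨j, hj⟩ := ucd_exists_root α hα hp (q + 1) M hM hM0 (b0 / a) (div_ne_zero hb ha)
      (by rw [div_pow, h, div_self (pow_ne_zero _ hb)])
    set z0 := α ^ j with hz0
    have hj' : a * z0 ^ (q + 1) = b0 := by
      rw [hz0, ← pow_mul, mul_comm j, ← hj]; field_simp
    have hz : z0 ≠ 0 := by
      intro h
      rw [h, zero_pow (by omega), mul_zero] at hj'
      exact hb hj'.symm
    have hkey : a ^ q * (z0 ^ q) ^ q = - (a * z0) := by
      apply mul_right_cancel₀ (pow_ne_zero q hz)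
      have := hbq
      rw [← hj', mul_pow, pow_succ, mul_pow] at this
      rw [mul_assoc, this]; ring
    obtain ⟨m, hm⟩ := hqM
    have hcard := ucd_card_roots α hp (q ^ 2 - 1) m (by
      rw [← hM, hm]
      have : q ^ 2 - 1 = (q + 1) * (q - 1) := by
        have := Nat.sq_sub_sq q 1
        simpa using this
      rw [this, mul_assoc]) hc z0 hz
    have heq : (Finset.univ.filter fun z : F => a * z + a ^ q * (z ^ q) ^ q = 0)
        = insert 0 (Finset.univ.filter fun z : F => z ^ (q ^ 2 - 1) = z0 ^ (q ^ 2 - 1)) := by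
      ext z
      simp only [Finset.mem_filter, Finset.mem_univ, true_and, Finset.mem_insert]
      rw [hsucc2] at hkey
      have hkey2 : a ^ q * z0 ^ (q ^ 2 - 1) = - a := by
        apply mul_right_cancel₀ hz
        rw [mul_assoc, hkey]; ring
      rw [hsucc2]
      have e1 : a * z + a ^ q * (z ^ (q ^ 2 - 1) * z)
          = a ^ q * (z ^ (q ^ 2 - 1) - z0 ^ (q ^ 2 - 1)) * z := by
        linear_combination z * hkey2
      rw [e1, mul_eq_zero, mul_eq_zero, sub_eq_zero]
      have := pow_ne_zero q ha
      tauto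
    rw [heq, Finset.card_insert_of_notMem, hcard]
    · omega
    · simp only [Finset.mem_filter, Finset.mem_univ, true_and]
      rw [zero_pow (by omega)]
      exact fun h => pow_ne_zero _ hz h.symm
  · rw [Finset.card_eq_one]
    refine ⟨0, ?_⟩
    ext z
    simp only [Finset.mem_filter, Finset.mem_univ, true_and, Finset.mem_singleton]
    constructor
    · intro hz
      by_contra hz0
      apply h
      set t := a * z ^ (q + 1) with ht
      have ht0 : t ≠ 0 := mul_ne_zero ha (pow_ne_zero _ hz0)
      have htq : t ^ q = - t := by
        rw [ht, mul_pow, pow_succ, mul_pow]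
        linear_combination (z ^ q) * hz
      have h1 : (t / b0) ^ (q - 1) = 1 := by
        rw [hsucc] at htq hbq
        have h2 : t ^ (q - 1) = -1 := mul_right_cancel₀ ht0 (by rw [htq]; ring)
        have h3 : b0 ^ (q - 1) = -1 := mul_right_cancel₀ hb (by rw [hbq]; ring)
        rw [div_pow, h2, h3]; simp
      obtain ⟨m, hm⟩ := hqM
      have h2 : (t / b0) ^ M = 1 := by rw [hm, pow_mul, h1, one_pow]
      rw [div_pow, div_eq_one_iff_eq (pow_ne_zero _ hb)] at h2
      rw [← h2, ht, mul_pow, ← pow_mul, hM, FiniteField.pow_card_sub_one_eq_one z hz0, mul_one]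
    · rintro rfl
      rw [zero_pow (by omega), zero_pow (by omega)]; ring

lemma ucd_S_mul (q : ℕ) (hq : 2 ≤ q) (ψ : AddChar F ℂ)
    (horth : ∀ a : F, ∑ x, ψ (x * a) = if a = 0 then (Fintype.card F : ℂ) else 0)
    (hfrob : ∀ x, ψ (x ^ q) = ψ x)
    (hadd : ∀ x y : F, (x + y) ^ q = x ^ q + y ^ q) (c : F) (hc : c + c ^ q = 1) (a : F) :
    (∑ x, ψ (a * x ^ (q + 1))) * (∑ x, ψ (-a * x ^ (q + 1)))
      = (Fintype.card F : ℂ) *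
        (Finset.univ.filter fun z : F => a * z + a ^ q * (z ^ q) ^ q = 0).card := by
  rw [mul_comm, Finset.sum_mul_sum]
  have h1 : ∀ y : F, ∑ x, ψ (-a * y ^ (q + 1)) * ψ (a * x ^ (q + 1))
      = ∑ z, ψ (a * z ^ (q + 1)) * ψ (y ^ q * (a * z + a ^ q * (z ^ q) ^ q)) := by
    intro y
    rw [← Equiv.sum_comp (Equiv.addLeft y)]
    apply Finset.sum_congr rfl
    intro z _
    have e1 : ψ (y ^ q * (a * z + a ^ q * (z ^ q) ^ q)) = ψ (y ^ q * (a * z) + a * z ^ q * y) := by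
      rw [mul_add, AddChar.map_add_eq_mul, AddChar.map_add_eq_mul, ← hfrob (a * z ^ q * y)]
      congr 2
      rw [mul_pow, mul_pow]; ring
    rw [e1, ← AddChar.map_add_eq_mul, ← AddChar.map_add_eq_mul]
    congr 1
    simp only [Equiv.coe_addLeft]
    rw [pow_succ (y + z), hadd]
    ring
  rw [Finset.sum_congr rfl fun y _ => h1 y, Finset.sum_comm]
  have h2 : ∀ z : F, ∑ y, ψ (a * z ^ (q + 1)) * ψ (y ^ q * (a * z + a ^ q * (z ^ q) ^ q))
      = if a * z + a ^ q * (z ^ q) ^ q = 0 then (Fintype.card F : ℂ) else 0 := by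
    intro z
    rw [← Finset.mul_sum]
    have e := Equiv.sum_comp (Equiv.ofBijective _ (ucd_pow_inj q hq hadd))
      (fun y => ψ (y * (a * z + a ^ q * (z ^ q) ^ q)))
    simp only [Equiv.ofBijective_apply] at e
    rw [e, horth]
    split_ifs with h
    · set t := a * z ^ (q + 1) with ht
      have htq : t ^ q = - t := by
        rw [ht, mul_pow, pow_succ, mul_pow]
        linear_combination (z ^ q) * h
      have : t = t * c + - (t * c) ^ q := by
        rw [mul_pow, htq]
        linear_combination (-t) * hc
      rw [this, AddChar.map_add_eq_mul, AddChar.map_neg_eq_inv, hfrob, mul_inv_cancel₀, one_mul]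
      intro h0
      have h3 := AddChar.map_add_eq_mul ψ (t * c) (-(t * c))
      rw [h0, add_neg_cancel, AddChar.map_zero_eq_one] at h3
      simp at h3
    · simp
  rw [Finset.sum_congr rfl fun z _ => h2 z, ← Finset.sum_filter, Finset.sum_const, nsmul_eq_mul,
    mul_comm]

lemma ucd_sum_pow (α : F) (hp : IsPrimitiveRoot α (Fintype.card F - 1)) (d k : ℕ)
    (hd : d * k = Fintype.card F - 1) (hd0 : 0 < d) (hk : 0 < k) (hα : IsPrimitiveElt α)
    (h : F → ℂ) :
    ∑ x ∈ Finset.univ.erase (0 : F), h (x ^ d)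
      = d * ∑ y ∈ Finset.univ.filter (fun y : F => y ^ k = 1), h y := by
  have hmaps : ∀ x ∈ Finset.univ.erase (0 : F), x ^ d ∈ Finset.univ.filter (fun y : F => y ^ k = 1) := by
    intro x hx
    simp only [Finset.mem_erase, Finset.mem_univ, and_true] at hx
    simp only [Finset.mem_filter, Finset.mem_univ, true_and]
    rw [← pow_mul, hd, FiniteField.pow_card_sub_one_eq_one x hx]
  rw [← Finset.sum_fiberwise_of_maps_to hmaps, Finset.mul_sum]
  apply Finset.sum_congr rfl
  intro y hy
  simp only [Finset.mem_filter, Finset.mem_univ, true_and] at hy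
  have hy0 : y ≠ 0 := by
    rintro rfl
    rw [zero_pow hk.ne'] at hy
    exact zero_ne_one hy
  obtain ⟨j, hj⟩ := ucd_exists_root α hα hp d k hd hk y hy0 hy
  have hj' : y = (α ^ j) ^ d := by rw [hj, mul_comm, pow_mul]
  have hz : α ^ j ≠ 0 := by
    intro h
    rw [h, zero_pow hd0.ne'] at hj'
    exact hy0 hj'
  rw [Finset.sum_congr rfl (g := fun _ => h y) (by
    intro x hx
    rw [(Finset.mem_filter.1 hx).2]), Finset.sum_const, nsmul_eq_mul]
  congr 2
  refine Eq.trans (congrArg Finset.card ?_)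
    (ucd_card_roots α hp d k hd (by rw [← hd]; positivity) _ hz)
  ext x
  simp only [Finset.mem_filter, Finset.mem_erase, Finset.mem_univ, true_and, and_true]
  rw [← hj']
  constructor
  · exact fun h => h.2
  · intro h
    refine ⟨?_, h⟩
    rintro rfl
    rw [zero_pow hd0.ne'] at h
    exact hy0 h.symm

/-- The value of the exponential sum of the Hermitian form. -/
lemma ucd_S (q beta M : ℕ) (hq : 2 ≤ q) (hcard : Fintype.card F = q ^ (2 * beta))
    (ψ : AddChar F ℂ)
    (horth : ∀ a : F, ∑ x, ψ (x * a) = if a = 0 then (Fintype.card F : ℂ) else 0)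
    (hfrob : ∀ x, ψ (x ^ q) = ψ x)
    (hadd : ∀ x y : F, (x + y) ^ q = x ^ q + y ^ q) (hintegral : ∀ x, IsIntegral ℤ (ψ x))
    (hM0 : 0 < M) (hM : (q + 1) * M = Fintype.card F - 1) (hqM : q - 1 ∣ M)
    (hneg : (-1 : F) ^ M = 1)
    (α : F) (hα : IsPrimitiveElt α) (hp : IsPrimitiveRoot α (Fintype.card F - 1))
    (b0 c : F) (hb : b0 ≠ 0) (hbq : b0 ^ q = - b0) (hc : c + c ^ q = 1) (a : F) (ha : a ≠ 0) :
    ∑ x ∈ Finset.univ.erase (0 : F), ψ (a * x ^ (q + 1))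
      = (-(q : ℂ)) ^ beta - 1 - (if a ^ M = b0 ^ M then (q + 1) * (-(q : ℂ)) ^ beta else 0) := by
  have h1 := ucd_S_mul q hq ψ horth hfrob hadd c hc a
  rw [ucd_S_neg q M ψ hM0 hM α hα hp hneg a, ucd_rad q M hq hM0 hM hqM hadd α hα hp b0 hb hbq a ha,
    hcard] at h1
  have h2 : ∑ x, ψ (a * x ^ (q + 1)) = 1 + ∑ x ∈ Finset.univ.erase (0 : F), ψ (a * x ^ (q + 1)) := by
    rw [← Finset.add_sum_erase _ _ (Finset.mem_univ (0 : F))]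
    simp
  have h3 := ucd_sum_pow α hp (q + 1) M hM (by omega) hM0 hα (fun y => ψ (a * y))
  have hT : IsIntegral ℤ (∑ y ∈ Finset.univ.filter (fun y : F => y ^ M = 1), ψ (a * y)) :=
    IsIntegral.sum _ fun y _ => hintegral _
  have h4 : ∑ x, ψ (a * x ^ (q + 1)) = 1 + (q + 1) *
      ∑ y ∈ Finset.univ.filter (fun y : F => y ^ M = 1), ψ (a * y) := by
    rw [h2, h3]; push_cast; rfl
  split_ifs at h1 ⊢ with h
  · have := ucd_sign q (beta + 1) hq _ _ hT h4 (by rw [h1]; push_cast; ring)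
    rw [h2] at this
    push_cast at this
    rw [pow_succ] at this
    linear_combination this
  · have := ucd_sign q beta hq _ _ hT h4 (by rw [h1]; push_cast; ring)
    rw [h2] at this
    push_cast at this
    linear_combination this

/-- Gauss periods in the semi-primitive case. -/
lemma ucd_P (q beta M e f k : ℕ) (eta : ℤ) (ψ : AddChar F ℂ)
    (hM0 : 0 < M) (hM : (q + 1) * M = Fintype.card F - 1)
    (hf : 0 < f) (hef : e * f = Fintype.card F - 1) (hfM : f = M * k)
    (heta : (e : ℤ) * eta = (-(q : ℤ)) ^ beta - 1)
    (α : F) (hp : IsPrimitiveRoot α (Fintype.card F - 1))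
    (b0 : F) (hb : b0 ≠ 0)
    (hS : ∀ a : F, a ≠ 0 → ∑ x ∈ Finset.univ.erase (0 : F), ψ (a * x ^ (q + 1))
      = (-(q : ℂ)) ^ beta - 1 - (if a ^ M = b0 ^ M then (q + 1) * (-(q : ℂ)) ^ beta else 0))
    (b v : F) (hb1 : b ≠ 0) (hv : v ≠ 0) :
    ∑ y ∈ Finset.univ.filter (fun y : F => y ^ f = v ^ f), ψ (b * y)
      = (eta : ℂ) - if (b * v) ^ f = b0 ^ f then (-(q : ℂ)) ^ beta else 0 := by
  set V := Finset.univ.filter (fun y : F => y ^ f = v ^ f) with hV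
  have hc : 0 < Fintype.card F - 1 := by rw [← hM]; positivity
  have hVcard : V.card = f := ucd_card_roots α hp f e (by rw [← hef, mul_comm]) hc v hv
  have hVmem : ∀ y, y ∈ V ↔ y ^ f = v ^ f := by intro y; simp [hV]
  have hV0 : ∀ y ∈ V, y ≠ 0 := by
    rintro y hy rfl
    rw [hVmem, zero_pow hf.ne'] at hy
    exact pow_ne_zero f hv hy.symm
  have h1 : ∀ x ∈ Finset.univ.erase (0 : F),
      ∑ y ∈ V, ψ (b * y) = ∑ y ∈ V, ψ (b * y * x ^ (q + 1)) := by
    intro x hx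
    have hx0 : x ≠ 0 := (Finset.mem_erase.1 hx).1
    symm
    refine Finset.sum_equiv (Equiv.mulRight₀ (x ^ (q + 1)) (pow_ne_zero _ hx0)) ?_ ?_
    · intro y
      rw [hVmem, hVmem]
      change _ ↔ (y * x ^ (q + 1)) ^ f = v ^ f
      have : (x ^ (q + 1)) ^ f = 1 := by
        rw [hfM, ← pow_mul, ← mul_assoc, hM, pow_mul, FiniteField.pow_card_sub_one_eq_one x hx0,
          one_pow]
      rw [mul_pow, this, mul_one]
    · intro y _
      change _ = ψ (b * (y * x ^ (q + 1)))
      rw [mul_assoc]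
  have h2 : ((Fintype.card F - 1 : ℕ) : ℂ) * ∑ y ∈ V, ψ (b * y)
      = ∑ y ∈ V, ((-(q : ℂ)) ^ beta - 1 -
        (if (b * y) ^ M = b0 ^ M then (q + 1) * (-(q : ℂ)) ^ beta else 0)) := by
    have h3 := Finset.sum_congr rfl h1
    rw [Finset.sum_const, Finset.card_erase_of_mem (Finset.mem_univ _), Finset.card_univ,
      nsmul_eq_mul, Finset.sum_comm] at h3
    rw [h3]
    apply Finset.sum_congr rfl
    intro y hy
    exact hS _ (mul_ne_zero hb1 (hV0 y hy))
  have h4 : (V.filter fun y => (b * y) ^ M = b0 ^ M).card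
      = if (b * v) ^ f = b0 ^ f then M else 0 := by
    split_ifs with h
    · refine Eq.trans (congrArg Finset.card ?_) (ucd_card_roots α hp M (q + 1)
        (by rw [← hM, mul_comm]) hc (b0 / b) (div_ne_zero hb hb1))
      ext y
      rw [Finset.mem_filter, hVmem]
      simp only [Finset.mem_filter, Finset.mem_univ, true_and]
      rw [div_pow, mul_pow, eq_div_iff (pow_ne_zero _ hb1), mul_comm (y ^ M)]
      constructor
      · exact fun h => h.2
      · intro h5
        refine ⟨?_, h5⟩
        apply mul_left_cancel₀ (pow_ne_zero f hb1)
        rw [← mul_pow b v, h, hfM, pow_mul, pow_mul, pow_mul, ← mul_pow, h5]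
    · rw [Finset.card_eq_zero, Finset.filter_eq_empty_iff]
      intro y hy h5
      apply h
      rw [mul_pow, ← (hVmem y).1 hy, ← mul_pow, hfM, pow_mul, h5, pow_mul]
  have hcC : ((Fintype.card F - 1 : ℕ) : ℂ) ≠ 0 := by exact_mod_cast hc.ne'
  apply mul_left_cancel₀ hcC
  rw [h2, Finset.sum_sub_distrib, Finset.sum_const, hVcard, ← Finset.sum_filter, Finset.sum_const,
    h4, nsmul_eq_mul, nsmul_eq_mul]
  have hetaC : (e : ℂ) * eta = (-(q : ℂ)) ^ beta - 1 := by exact_mod_cast heta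
  have hefC : (e : ℂ) * f = ((Fintype.card F - 1 : ℕ) : ℂ) := by exact_mod_cast hef
  have hMC : ((q : ℂ) + 1) * M = ((Fintype.card F - 1 : ℕ) : ℂ) := by exact_mod_cast hM
  split_ifs
  · linear_combination (-(f : ℂ)) * hetaC + (eta : ℂ) * hefC - (-(q : ℂ)) ^ beta * hMC
  · push_cast
    linear_combination (-(f : ℂ)) * hetaC + (eta : ℂ) * hefC

/-- Uniform cyclotomic numbers. -/
lemma ucd_N (q beta e f : ℕ) (eta : ℤ) (ψ : AddChar F ℂ) (hcard : Fintype.card F = q ^ (2 * beta))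
    (horth : ∀ a : F, ∑ x, ψ (x * a) = if a = 0 then (Fintype.card F : ℂ) else 0)
    (hf : 0 < f) (hef : e * f = Fintype.card F - 1) (hc : 0 < Fintype.card F - 1)
    (heta : (e : ℤ) * eta = (-(q : ℤ)) ^ beta - 1)
    (α : F) (hp : IsPrimitiveRoot α (Fintype.card F - 1))
    (b0 : F) (hb : b0 ≠ 0) (hneg : (-1 : F) ^ f = 1)
    (hP : ∀ b v : F, b ≠ 0 → v ≠ 0 →
      ∑ y ∈ Finset.univ.filter (fun y : F => y ^ f = v ^ f), ψ (b * y)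
      = (eta : ℂ) - if (b * v) ^ f = b0 ^ f then (-(q : ℂ)) ^ beta else 0)
    (v v' x : F) (hv : v ≠ 0) (hv' : v' ≠ 0) (hx : x ≠ 0) :
    (((Finset.univ.filter (fun y : F => y ^ f = v ^ f) ×ˢ
      Finset.univ.filter (fun y : F => y ^ f = v' ^ f)).filter fun p => x = p.1 - p.2).card : ℤ)
      = eta ^ 2 + eta * ((if x ^ f = v ^ f then 1 else 0) + (if x ^ f = v' ^ f then 1 else 0))
        + if v ^ f = v' ^ f then eta - (if x ^ f = v ^ f then (-(q : ℤ)) ^ beta else 0) else 0 := by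
  set r : ℂ := (-(q : ℂ)) ^ beta with hr
  have hetaC : (e : ℂ) * eta = r - 1 := by rw [hr]; exact_mod_cast heta
  have hr2 : r ^ 2 = (Fintype.card F : ℂ) := by
    rw [hr, hcard, ← pow_mul, mul_comm beta 2, pow_mul, neg_sq, pow_mul]; push_cast; rfl
  have hefC : (e : ℂ) * f = r ^ 2 - 1 := by
    rw [hr2]
    have : (((e * f : ℕ)) : ℂ) = ((Fintype.card F - 1 : ℕ) : ℂ) := by rw [hef]
    rw [Nat.cast_sub (by omega)] at this
    exact_mod_cast this
  have he0 : (e : ℂ) ≠ 0 := by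
    intro h
    have : e = 0 := by exact_mod_cast h
    rw [this] at hef; omega
  have hfC : (f : ℂ) = eta * (r + 1) := by
    apply mul_left_cancel₀ he0
    linear_combination hefC - (r + 1) * hetaC
  have hr0 : r ^ 2 ≠ 0 := by
    rw [hr2]
    have : Fintype.card F ≠ 0 := by omega
    exact_mod_cast this
  set V := Finset.univ.filter (fun y : F => y ^ f = v ^ f) with hV
  set V' := Finset.univ.filter (fun y : F => y ^ f = v' ^ f) with hV'
  have hVcard : V.card = f := ucd_card_roots α hp f e (by rw [← hef, mul_comm]) hc v hv
  have hVcard' : V'.card = f := ucd_card_roots α hp f e (by rw [← hef, mul_comm]) hc v' hv'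
  have hnegf : ∀ y : F, (-y) ^ f = y ^ f := by
    intro y
    rw [neg_eq_neg_one_mul, mul_pow, hneg, one_mul]
  -- orthogonality
  have h1 : r ^ 2 * (((V ×ˢ V').filter fun p => x = p.1 - p.2).card : ℂ)
      = ∑ c : F, (∑ y ∈ V, ψ (c * y)) * (∑ z ∈ V', ψ (-c * z)) * ψ (c * -x) := by
    have e1 : ∀ c : F, (∑ y ∈ V, ψ (c * y)) * (∑ z ∈ V', ψ (-c * z)) * ψ (c * -x)
        = ∑ p ∈ V ×ˢ V', ψ (c * (p.1 - p.2 - x)) := by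
      intro c
      rw [Finset.sum_mul_sum, Finset.sum_product, Finset.sum_mul]
      apply Finset.sum_congr rfl
      intro y _
      rw [Finset.sum_mul]
      apply Finset.sum_congr rfl
      intro z _
      rw [← AddChar.map_add_eq_mul, ← AddChar.map_add_eq_mul]
      congr 1
      ring
    rw [Finset.sum_congr rfl fun c _ => e1 c, Finset.sum_comm,
      Finset.sum_congr rfl fun p _ => horth _, ← Finset.sum_filter, Finset.sum_const, nsmul_eq_mul,
      hr2, mul_comm]
    congr 3
    ext p
    simp only [Finset.mem_filter, sub_eq_zero, eq_comm]
  have hE : ∑ c ∈ Finset.univ.erase (0 : F), ψ (c * -x) = -1 := by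
    have := horth (-x)
    rw [if_neg (neg_ne_zero.2 hx), ← Finset.add_sum_erase _ _ (Finset.mem_univ (0 : F))] at this
    simp only [zero_mul, AddChar.map_zero_eq_one] at this
    linear_combination this
  have hA : ∀ v : F, v ≠ 0 → ∑ c ∈ Finset.univ.erase (0 : F),
      (if (c * v) ^ f = b0 ^ f then ψ (c * -x) else 0)
      = (eta : ℂ) - if x ^ f = v ^ f then r else 0 := by
    intro v hv
    have h2 := hP (-x) (b0 / v) (neg_ne_zero.2 hx) (div_ne_zero hb hv)
    have e2 : ((-x * (b0 / v)) ^ f = b0 ^ f) ↔ x ^ f = v ^ f := by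
      rw [mul_pow, hnegf, div_pow, mul_div_assoc', div_eq_iff (pow_ne_zero _ hv), mul_comm,
        mul_right_inj' (pow_ne_zero _ hb)]
    simp only [e2] at h2
    rw [← h2, ← Finset.sum_filter]
    refine Finset.sum_congr ?_ fun c _ => by rw [mul_comm]
    ext c
    simp only [Finset.mem_filter, Finset.mem_erase, Finset.mem_univ, true_and, and_true]
    rw [mul_pow, div_pow, eq_div_iff (pow_ne_zero _ hv)]
    constructor
    · exact fun h => h.2
    · intro h
      refine ⟨?_, h⟩
      rintro rfl
      rw [zero_pow hf.ne', zero_mul] at h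
      exact pow_ne_zero f hb h.symm
  have h3 : ∑ c ∈ Finset.univ.erase (0 : F),
      (∑ y ∈ V, ψ (c * y)) * (∑ z ∈ V', ψ (-c * z)) * ψ (c * -x)
      = ∑ c ∈ Finset.univ.erase (0 : F), ((eta : ℂ) ^ 2 * ψ (c * -x)
        - eta * r * (if (c * v) ^ f = b0 ^ f then ψ (c * -x) else 0)
        - eta * r * (if (c * v') ^ f = b0 ^ f then ψ (c * -x) else 0)
        + (if v ^ f = v' ^ f then r ^ 2 else 0) *
          (if (c * v) ^ f = b0 ^ f then ψ (c * -x) else 0)) := by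
    apply Finset.sum_congr rfl
    intro c hcm
    have hc0 : c ≠ 0 := (Finset.mem_erase.1 hcm).1
    rw [hP c v hc0 hv, hP (-c) v' (neg_ne_zero.2 hc0) hv']
    have e3 : (-c * v') ^ f = (c * v') ^ f := by rw [neg_mul, hnegf]
    rw [e3]
    by_cases h4 : (c * v) ^ f = b0 ^ f
    · have h5 : (c * v') ^ f = b0 ^ f ↔ v ^ f = v' ^ f := by
        rw [← h4, mul_pow, mul_pow, mul_right_inj' (pow_ne_zero _ hc0), eq_comm]
      simp only [h4, h5, if_true]
      split_ifs <;> ring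
    · simp only [h4, if_false]
      split_ifs <;> ring
  rw [← Finset.add_sum_erase _ _ (Finset.mem_univ (0 : F)), h3, Finset.sum_add_distrib,
    Finset.sum_sub_distrib, Finset.sum_sub_distrib, ← Finset.mul_sum, ← Finset.mul_sum,
    ← Finset.mul_sum, ← Finset.mul_sum, hE, hA v hv, hA v' hv'] at h1
  simp only [zero_mul, neg_zero, AddChar.map_zero_eq_one, Finset.sum_const, hVcard, hVcard',
    nsmul_eq_mul, mul_one] at h1
  have h6 : ((((V ×ˢ V').filter fun p => x = p.1 - p.2).card : ℤ) : ℂ)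
      = ((eta ^ 2 + eta * ((if x ^ f = v ^ f then 1 else 0) + (if x ^ f = v' ^ f then 1 else 0))
        + if v ^ f = v' ^ f then eta - (if x ^ f = v ^ f then (-(q : ℤ)) ^ beta else 0) else 0 : ℤ) : ℂ) := by
    apply mul_left_cancel₀ hr0
    rw [Int.cast_natCast, h1, hfC]
    push_cast
    rw [← hr]
    split_ifs <;> ring
  exact_mod_cast h6

lemma ucd_ind {ι G : Type*} [DecidableEq G] (s : Finset ι) (C : ι → Finset G)
    (hd : (s : Set ι).PairwiseDisjoint C) (x : G) :
    (∑ i ∈ s, if x ∈ C i then (1 : ℤ) else 0) = if x ∈ s.biUnion C then 1 else 0 := by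
  have := Finset.sum_biUnion (f := fun y => if x = y then (1 : ℤ) else 0) hd
  simp only [Finset.sum_ite_eq] at this
  exact this.symm

lemma ucd_count_ext {G : Type*} [AddGroup G] [DecidableEq G] (D₁ D₂ : Finset G) (x : G) :
    (extDiff D₁ D₂).count x = ((D₁ ×ˢ D₂).filter fun p => x = p.1 - p.2).card := by
  unfold extDiff
  rw [Multiset.count_map]
  rfl

lemma ucd_count_ext_sum {G : Type*} [AddGroup G] [DecidableEq G] (D₁ D₂ : Finset G) (x : G) :
    ((extDiff D₁ D₂).count x : ℤ) = ∑ y ∈ D₁, ∑ z ∈ D₂, if x = y - z then (1 : ℤ) else 0 := by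
  rw [ucd_count_ext, ← Finset.sum_product', Finset.sum_boole]

lemma ucd_count_int {G : Type*} [AddGroup G] [DecidableEq G] (D : Finset G) (x : G) :
    (intDiff D).count x = if x = 0 then 0 else (extDiff D D).count x := by
  rw [ucd_count_ext]
  unfold intDiff
  rw [Multiset.count_map]
  change (((D ×ˢ D).filter fun p => p.1 ≠ p.2).filter fun p => x = p.1 - p.2).card = _
  rw [Finset.filter_filter]
  split_ifs with h
  · subst h
    rw [Finset.card_eq_zero, Finset.filter_eq_empty_iff]
    rintro p - ⟨h1, h2⟩
    exact h1 (sub_eq_zero.1 h2.symm)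
  · congr 1
    apply Finset.filter_congr
    intro p _
    constructor
    · exact fun h => h.2
    · intro h2
      refine ⟨fun h3 => h ?_, h2⟩
      rw [h2, h3, sub_self]

lemma ucd_count_ext_zero {G : Type*} [AddGroup G] [DecidableEq G] (D₁ D₂ : Finset G)
    (h : Disjoint D₁ D₂) : (extDiff D₁ D₂).count 0 = 0 := by
  rw [ucd_count_ext, Finset.card_eq_zero, Finset.filter_eq_empty_iff]
  rintro p hp h2
  rw [Finset.mem_product] at hp
  have := sub_eq_zero.1 h2.symm
  exact Finset.disjoint_left.1 h hp.1 (this ▸ hp.2)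

lemma ucd_union {G : Type*} [AddGroup G] [DecidableEq G] (C : ℕ → Finset G) (e u w : ℕ)
    (eta r : ℤ) (I : Fin w → Finset ℕ)
    (hI : ∀ a, I a ⊆ Finset.range e) (hIcard : ∀ a, (I a).card = u)
    (hIdisj : ∀ a b, a ≠ b → Disjoint (I a) (I b))
    (hC : ∀ i < e, ∀ j < e, i ≠ j → Disjoint (C i) (C j)) (x : G)
    (hN : ∀ i < e, ∀ j < e, ((extDiff (C i) (C j)).count x : ℤ) =
      eta ^ 2 + eta * ((if x ∈ C i then 1 else 0) + (if x ∈ C j then 1 else 0))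
        + if i = j then eta - r * (if x ∈ C i then 1 else 0) else 0) (a b : Fin w) :
    ((extDiff ((I a).biUnion C) ((I b).biUnion C)).count x : ℤ) =
      u ^ 2 * eta ^ 2 + u * eta * ((if x ∈ (I a).biUnion C then 1 else 0)
        + (if x ∈ (I b).biUnion C then 1 else 0))
        + if a = b then u * eta - r * (if x ∈ (I a).biUnion C then 1 else 0) else 0 := by
  have hlt : ∀ a, ∀ i ∈ I a, i < e := fun a i hi => Finset.mem_range.1 (hI a hi)
  have hpd : ∀ a, ((I a : Finset ℕ) : Set ℕ).PairwiseDisjoint C := by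
    intro a i hi j hj hij
    exact hC i (hlt a i hi) j (hlt a j hj) hij
  have h1 : ((extDiff ((I a).biUnion C) ((I b).biUnion C)).count x : ℤ)
      = ∑ i ∈ I a, ∑ j ∈ I b, ((extDiff (C i) (C j)).count x : ℤ) := by
    rw [ucd_count_ext_sum, Finset.sum_biUnion (hpd a)]
    apply Finset.sum_congr rfl
    intro i _
    simp_rw [ucd_count_ext_sum]
    rw [Finset.sum_comm, Finset.sum_biUnion (hpd b)]
    apply Finset.sum_congr rfl
    intro j _
    rw [Finset.sum_comm]
  rw [h1, Finset.sum_congr rfl fun i hi => Finset.sum_congr rfl fun j hj =>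
    hN i (hlt a i hi) j (hlt b j hj)]
  rw [← ucd_ind _ _ (hpd a) x, ← ucd_ind _ _ (hpd b) x]
  simp only [Finset.sum_add_distrib, mul_add, ← Finset.mul_sum, Finset.sum_const, hIcard,
    nsmul_eq_mul]
  have h2 : (∑ i ∈ I a, ∑ j ∈ I b, if i = j then eta - r * (if x ∈ C i then (1 : ℤ) else 0) else 0)
      = if a = b then u * eta - r * (∑ i ∈ I a, if x ∈ C i then (1 : ℤ) else 0) else 0 := by
    simp only [Finset.sum_ite_eq]
    split_ifs with hab
    · subst hab
      rw [Finset.sum_congr rfl fun i hi => if_pos hi, Finset.sum_sub_distrib, ← Finset.mul_sum,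
        Finset.sum_const, hIcard, nsmul_eq_mul]
    · apply Finset.sum_eq_zero
      intro i hi
      rw [if_neg (Finset.disjoint_left.1 (hIdisj a b hab) hi)]
  rw [h2]
  ring

/-- Counting formulas for the whole family. -/
lemma ucd_family {G : Type*} [AddGroup G] [DecidableEq G] (w : ℕ) (D : Fin w → Finset G)
    (t r : ℤ) (hD : ∀ a b, a ≠ b → Disjoint (D a) (D b)) (x : G) (hx : x ≠ 0)
    (h : ∀ a b, ((extDiff (D a) (D b)).count x : ℤ) =
      t ^ 2 + t * ((if x ∈ D a then 1 else 0) + (if x ∈ D b then 1 else 0))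
        + if a = b then t - r * (if x ∈ D a then 1 else 0) else 0) :
    ((famInt D).count x : ℤ) = w * (t ^ 2 + t) + (2 * t - r) * (if x ∈ famU D then 1 else 0) ∧
    ((famExt D).count x : ℤ) = w * (w - 1) * t ^ 2
      + 2 * (w - 1) * t * (if x ∈ famU D then 1 else 0) := by
  have hU : (∑ a, if x ∈ D a then (1 : ℤ) else 0) = if x ∈ famU D then 1 else 0 := by
    unfold famU
    exact ucd_ind _ _ (fun a _ b _ hab => hD a b hab) x
  constructor
  · unfold famInt
    rw [Multiset.count_sum']
    push_cast
    have : ∀ a, ((intDiff (D a)).count x : ℤ)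
        = (t ^ 2 + t) + (2 * t - r) * (if x ∈ D a then 1 else 0) := by
      intro a
      rw [ucd_count_int, if_neg hx, h a a, if_pos rfl]
      ring
    rw [Finset.sum_congr rfl fun a _ => this a, Finset.sum_add_distrib, ← Finset.mul_sum, hU]
    simp
  · unfold famExt
    rw [Multiset.count_sum']
    push_cast
    have : ∀ a b, ((if b = a then 0 else extDiff (D a) (D b) : Multiset G).count x : ℤ)
        = (t ^ 2 + t * ((if x ∈ D a then 1 else 0) + (if x ∈ D b then 1 else 0)))
          - if a = b then t ^ 2 + 2 * t * (if x ∈ D a then 1 else 0) else 0 := by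
      intro a b
      by_cases hab : b = a
      · subst hab
        simp
        split_ifs <;> ring
      · rw [if_neg hab, h a b, if_neg (Ne.symm hab), if_neg (Ne.symm hab)]
        ring
    have h3 : ∀ a, ((Multiset.count x (∑ b, if b = a then 0 else extDiff (D a) (D b)) : ℕ) : ℤ)
        = (w - 1) * t ^ 2 + (w - 2) * t * (if x ∈ D a then 1 else 0)
          + t * (if x ∈ famU D then 1 else 0) := by
      intro a
      rw [Multiset.count_sum']
      push_cast
      rw [Finset.sum_congr rfl fun b _ => this a b, Finset.sum_sub_distrib, Finset.sum_ite_eq,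
        Finset.sum_add_distrib, ← Finset.mul_sum, Finset.sum_add_distrib, hU]
      simp only [Finset.sum_const, Finset.card_univ, Fintype.card_fin, nsmul_eq_mul,
        Finset.mem_univ, if_true]
      ring
    rw [Finset.sum_congr rfl fun a _ => h3 a, Finset.sum_add_distrib, Finset.sum_add_distrib,
      ← Finset.mul_sum Finset.univ (fun a => if x ∈ D a then (1 : ℤ) else 0), hU]
    simp only [Finset.sum_const, Finset.card_univ, Fintype.card_fin, nsmul_eq_mul]
    ring

lemma ucd_family_zero {G : Type*} [AddGroup G] [DecidableEq G] (w : ℕ) (D : Fin w → Finset G)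
    (hD : ∀ a b, a ≠ b → Disjoint (D a) (D b)) :
    (famInt D).count 0 = 0 ∧ (famExt D).count 0 = 0 := by
  constructor
  · unfold famInt
    rw [Multiset.count_sum']
    apply Finset.sum_eq_zero
    intro a _
    rw [ucd_count_int, if_pos rfl]
  · unfold famExt
    rw [Multiset.count_sum']
    apply Finset.sum_eq_zero
    intro a _
    rw [Multiset.count_sum']
    apply Finset.sum_eq_zero
    intro b _
    split_ifs with h
    · simp
    · exact ucd_count_ext_zero _ _ (hD a b (Ne.symm h))

/-- The class-level facts assembled. -/
lemma ucd_classes (q beta e f : ℕ) (eta : ℤ) (α : F)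
    (hq : IsPrimePow q) (hbeta : 0 < beta)
    (hcard : Fintype.card F = q ^ (2 * beta))
    (hdvd : e ∣ q + 1)
    (hfe : e * f = q ^ (2 * beta) - 1) (hf : 0 < f)
    (heta : (e : ℤ) * eta = (-(q : ℤ)) ^ beta - 1)
    (hα : IsPrimitiveElt α) :
    (∀ i, (cyclo α e f i).card = f) ∧ (∀ i, (0 : F) ∉ cyclo α e f i) ∧
    (∀ i < e, ∀ j < e, i ≠ j → Disjoint (cyclo α e f i) (cyclo α e f j)) ∧
    ∀ x : F, x ≠ 0 → ∀ i < e, ∀ j < e,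
      ((extDiff (cyclo α e f i) (cyclo α e f j)).count x : ℤ) =
      eta ^ 2 + eta * ((if x ∈ cyclo α e f i then 1 else 0) + (if x ∈ cyclo α e f j then 1 else 0))
        + if i = j then eta - (-(q : ℤ)) ^ beta * (if x ∈ cyclo α e f i then 1 else 0) else 0 := by
  have hq2 : 2 ≤ q := hq.two_le
  obtain ⟨ψ, horth, hfrob, hadd, hintegral⟩ := ucd_exists_psi (F := F) q beta hq hcard
  obtain ⟨K, hK0, hK⟩ := ucd_arith q beta hq2 hbeta
  rw [← hcard] at hK hfe
  have hqq : q ^ 2 - 1 = (q + 1) * (q - 1) := by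
    have := Nat.sq_sub_sq q 1
    simpa using this
  have hq3 : 3 ≤ q ^ 2 - 1 := by
    rw [hqq]
    calc 3 = 3 * 1 := rfl
      _ ≤ (q + 1) * (q - 1) := Nat.mul_le_mul (by omega) (by omega)
  have hc3 : 3 ≤ Fintype.card F - 1 := by
    rw [← hK]
    calc 3 = 3 * 1 := rfl
      _ ≤ (q ^ 2 - 1) * K := Nat.mul_le_mul hq3 hK0
  have hc : 0 < Fintype.card F - 1 := by omega
  obtain ⟨h0, hp⟩ := ucd_prim α hα (by omega)
  have hM : (q + 1) * ((q - 1) * K) = Fintype.card F - 1 := by rw [← hK, hqq, mul_assoc]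
  have hM0 : 0 < (q - 1) * K := Nat.mul_pos (by omega) hK0
  have hneg : (-1 : F) ^ ((q - 1) * K) = 1 := by
    have h1 := ucd_neg_pow q hq2 hadd (1 : F)
    rw [one_pow] at h1
    have h2 : (-1 : F) ^ (q - 1) = 1 := by
      have h3 : (-1 : F) ^ (q - 1) * (-1) = 1 * (-1) := by
        rw [← pow_succ, one_mul]
        have : q - 1 + 1 = q := by omega
        rw [this, h1]
      exact mul_right_cancel₀ (by simp) h3
    rw [pow_mul, h2, one_pow]
  obtain ⟨b0, c, hb, hbq, hcc⟩ := ucd_b0 q K hq2 hK0 hK hadd α h0 hp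
  have hS := ucd_S q beta ((q - 1) * K) hq2 hcard ψ horth hfrob hadd hintegral hM0 hM ⟨K, rfl⟩ hneg α hα
    hp b0 c hb hbq hcc
  obtain ⟨k, hk⟩ := hdvd
  have he0 : 0 < e := Nat.pos_of_ne_zero (by rintro rfl; omega)
  have hfM : f = (q - 1) * K * k := by
    apply Nat.eq_of_mul_eq_mul_left he0
    rw [hfe, ← hM, hk]; ring
  have hnegf : (-1 : F) ^ f = 1 := by rw [hfM, pow_mul, hneg, one_pow]
  have hP := ucd_P q beta _ e f k eta ψ hM0 hM hf hfe hfM heta α hp b0 hb hS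
  have hN := ucd_N q beta e f eta ψ hcard horth hf hfe hc heta α hp b0 hb hnegf
    (fun b v h1 h2 => hP b v h1 h2)
  have hmem := ucd_mem_cyclo α hα h0 hp e f hfe hf
  have hset : ∀ i, cyclo α e f i = Finset.univ.filter (fun y : F => y ^ f = (α ^ i) ^ f) := by
    intro i
    ext y
    rw [hmem]
    simp
  have hinj : ∀ i < e, ∀ j < e, (α ^ i) ^ f = (α ^ j) ^ f → i = j := by
    intro i hi j hj hij
    rw [← pow_mul, ← pow_mul] at hij
    have h1 := hp.pow_inj (by rw [← hfe]; exact Nat.mul_lt_mul_of_pos_right hi hf)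
      (by rw [← hfe]; exact Nat.mul_lt_mul_of_pos_right hj hf) hij
    exact Nat.eq_of_mul_eq_mul_right hf h1
  refine ⟨?_, ?_, ?_, ?_⟩
  · intro i
    rw [hset]
    exact ucd_card_roots α hp f e (by rw [← hfe, mul_comm]) hc _ (pow_ne_zero _ h0)
  · intro i h
    rw [hmem, zero_pow hf.ne'] at h
    exact pow_ne_zero f (pow_ne_zero i h0) h.symm
  · intro i hi j hj hij
    rw [Finset.disjoint_left]
    intro x hx hx'
    rw [hmem] at hx hx'
    exact hij (hinj i hi j hj (hx.symm.trans hx'))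
  · intro x hx i hi j hj
    rw [ucd_count_ext]
    have h1 := hN (α ^ i) (α ^ j) x (pow_ne_zero _ h0) (pow_ne_zero _ h0) hx
    rw [← hset, ← hset] at h1
    rw [h1]
    simp only [hmem]
    have h2 : ((α ^ i) ^ f = (α ^ j) ^ f) ↔ i = j :=
      ⟨hinj i hi j hj, fun h => by rw [h]⟩
    simp only [h2, mul_ite, mul_one, mul_zero]

end Helpers

/-- Theorem: let `q′ = q^{2β}`, `e ≥ 3` with `e ∣ q+1`, `η = ((-q)^β-1)/e`, `f = (q′-1)/e`,
and let `D_a = ⋃_{i ∈ I_a} C_i^e` for pairwise disjoint `u`-subsets `I₁,…,I_w` of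
`{0,…,e-1}` with `wu ≤ e`.  Then (i) `{D_a}` is a DPDF with the stated parameters; (ii) for
`w ≥ 2` it is an EPDF with the stated parameters; (iii) if `⋃ D_a ≠ GF(q′)*`, it is a DDF iff
each `D_a` is a difference set; (iv) for `w ≥ 2`, if `⋃ D_a ≠ GF(q′)*`, it is not an EDF. -/
theorem unions_of_classes_dpdf_epdf {F : Type*} [Field F] [Fintype F] [DecidableEq F]
    (q beta e u w f : ℕ) (eta : ℤ) (α : F) (I : Fin w → Finset ℕ)
    (hq : IsPrimePow q) (hbeta : 0 < beta)
    (hcard : Fintype.card F = q ^ (2 * beta))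
    (he : 3 ≤ e) (hdvd : e ∣ q + 1)
    (hfe : e * f = q ^ (2 * beta) - 1) (hf : 1 < f)
    (heta : (e : ℤ) * eta = (-(q : ℤ)) ^ beta - 1)
    (hα : IsPrimitiveElt α)
    (hu : 0 < u) (hw : 0 < w) (hwu : w * u ≤ e)
    (hI : ∀ a, I a ⊆ Finset.range e) (hIcard : ∀ a, (I a).card = u)
    (hIdisj : ∀ a b, a ≠ b → Disjoint (I a) (I b)) :
    ∀ D : Fin w → Finset F, D = (fun a => (I a).biUnion fun i => cyclo α e f i) →
    (IsDPDF (q ^ (2 * beta)) w (u * f)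
        ((u : ℤ) ^ 2 * eta ^ 2 + (3 * (u : ℤ) - (e : ℤ)) * eta - 1 +
          ((w : ℤ) - 1) * ((u : ℤ) ^ 2 * eta ^ 2 + (u : ℤ) * eta))
        ((w : ℤ) * ((u : ℤ) ^ 2 * eta ^ 2 + (u : ℤ) * eta)) D) ∧
    (2 ≤ w → IsEPDF (q ^ (2 * beta)) w (u * f)
        ((w : ℤ) * ((w : ℤ) - 1) * (u : ℤ) ^ 2 * eta ^ 2 + 2 * ((w : ℤ) - 1) * (u : ℤ) * eta)
        ((w : ℤ) * ((w : ℤ) - 1) * (u : ℤ) ^ 2 * eta ^ 2) D) ∧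
    (famU D ≠ Finset.univ.erase (0 : F) →
      ((∃ lam : ℤ, IsDDF (q ^ (2 * beta)) w (u * f) lam D) ↔
        (∀ a, ∃ lam : ℤ, IsDS (q ^ (2 * beta)) (u * f) lam (D a)))) ∧
    (2 ≤ w → famU D ≠ Finset.univ.erase (0 : F) →
      ¬ ∃ lam : ℤ, IsEDF (q ^ (2 * beta)) w (u * f) lam D) := by
  intro D hDdef
  obtain ⟨hCcard, hC0, hCd, hN⟩ := ucd_classes q beta e f eta α hq hbeta hcard hdvd hfe
    (by omega) heta hα
  have hq2 : 2 ≤ q := hq.two_le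
  have hDa : ∀ a, D a = (I a).biUnion fun i => cyclo α e f i := by rw [hDdef]; exact fun a => rfl
  have hlt : ∀ a, ∀ i ∈ I a, i < e := fun a i hi => Finset.mem_range.1 (hI a hi)
  have hD0 : ∀ a, (0 : F) ∉ D a := by
    intro a h
    rw [hDa, Finset.mem_biUnion] at h
    obtain ⟨i, _, hi⟩ := h
    exact hC0 i hi
  have hDd : ∀ a b, a ≠ b → Disjoint (D a) (D b) := by
    intro a b hab
    rw [hDa, hDa, Finset.disjoint_biUnion_left]
    intro i hi
    rw [Finset.disjoint_biUnion_right]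
    intro j hj
    refine hCd i (hlt a i hi) j (hlt b j hj) ?_
    rintro rfl
    exact Finset.disjoint_left.1 (hIdisj a b hab) hi hj
  have hDcard : ∀ a, (D a).card = u * f := by
    intro a
    rw [hDa, Finset.card_biUnion]
    · rw [Finset.sum_congr rfl fun i _ => hCcard i, Finset.sum_const, hIcard, smul_eq_mul]
    · intro i hi j hj hij
      exact hCd i (hlt a i hi) j (hlt a j hj) hij
  have hext : ∀ x : F, x ≠ 0 → ∀ a b, ((extDiff (D a) (D b)).count x : ℤ) =
      ((u : ℤ) * eta) ^ 2 + (u : ℤ) * eta * ((if x ∈ D a then 1 else 0) + (if x ∈ D b then 1 else 0))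
        + if a = b then (u : ℤ) * eta - (-(q : ℤ)) ^ beta * (if x ∈ D a then 1 else 0) else 0 := by
    intro x hx a b
    have := ucd_union (fun i => cyclo α e f i) e u w eta ((-(q : ℤ)) ^ beta) I hI hIcard hIdisj hCd x
      (hN x hx) a b
    rw [hDa, hDa, this, mul_pow]
  have hfam := fun x hx => ucd_family w D ((u : ℤ) * eta) ((-(q : ℤ)) ^ beta) hDd x hx (hext x hx)
  have hz := ucd_family_zero w D hDd
  have hU0 : (0 : F) ∉ famU D := by
    unfold famU
    rw [Finset.mem_biUnion]
    rintro ⟨a, _, ha⟩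
    exact hD0 a ha
  have hr : (-(q : ℤ)) ^ beta = e * eta + 1 := by rw [heta]; ring
  have hshape : FamShape (q ^ (2 * beta)) w (u * f) D :=
    ⟨hcard, Fintype.card_fin w, hDcard, hDd⟩
  have heta0 : eta ≠ 0 := by
    rintro rfl
    rw [mul_zero, zero_add] at hr
    have h1 := congrArg Int.natAbs hr
    rw [Int.natAbs_pow, Int.natAbs_neg, Int.natAbs_natCast] at h1
    have : 1 < q ^ beta := Nat.one_lt_pow hbeta.ne' (by omega)
    simp at h1
    omega
  have hne : ∀ a, ∃ x, x ∈ D a := by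
    intro a
    have : 0 < (D a).card := by rw [hDcard]; exact Nat.mul_pos hu (by omega)
    exact Finset.card_pos.1 this
  have hsub : ∀ a, D a ⊆ famU D := fun a => Finset.subset_biUnion_of_mem D (Finset.mem_univ a)
  have hout : famU D ≠ Finset.univ.erase (0 : F) → ∃ x : F, x ≠ 0 ∧ x ∉ famU D := by
    intro h
    by_contra hcon
    push Not at hcon
    apply h
    ext x
    simp only [Finset.mem_erase, Finset.mem_univ, and_true]
    exact ⟨fun hx h0 => hU0 (h0 ▸ hx), hcon x⟩
  obtain ⟨y, hy⟩ := hne ⟨0, hw⟩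
  have hyU := hsub _ hy
  have hy0 : y ≠ 0 := fun h => hD0 _ (h ▸ hy)
  refine ⟨⟨hshape, hD0, ?_⟩, fun hw2 => ⟨hshape, hD0, ?_⟩, fun hS => ?_, fun hw2 hS => ?_⟩
  · intro x
    by_cases hx : x = 0
    · subst hx
      rw [if_neg hU0, if_pos rfl, hz.1]; rfl
    · rw [(hfam x hx).1, if_neg hx, hr]
      split_ifs <;> ring
  · intro x
    by_cases hx : x = 0
    · subst hx
      rw [if_neg hU0, if_pos rfl, hz.2]; rfl
    · rw [(hfam x hx).2, if_neg hx]
      split_ifs <;> ring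
  · obtain ⟨x, hx0, hxU⟩ := hout hS
    constructor
    · rintro ⟨lam, -, hlam⟩ a
      have h1 := hlam x
      have h2 := hlam y
      rw [(hfam x hx0).1, if_neg hxU, if_neg hx0] at h1
      rw [(hfam y hy0).1, if_pos hyU, if_neg hy0] at h2
      have h3 : 2 * ((u : ℤ) * eta) - (-(q : ℤ)) ^ beta = 0 := by linarith
      refine ⟨((u : ℤ) * eta) ^ 2 + (u : ℤ) * eta, hcard, hDcard a, fun z => ?_⟩
      rw [ucd_count_int]
      by_cases hz0 : z = 0
      · simp [hz0]
      · rw [if_neg hz0, if_neg hz0, hext z hz0 a a, if_pos rfl]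
        linear_combination (if z ∈ D a then 1 else 0) * h3
    · intro h
      obtain ⟨lam, -, -, hlam⟩ := h ⟨0, hw⟩
      have h1 := hlam x
      have h2 := hlam y
      rw [ucd_count_int, if_neg hx0, if_neg hx0, hext x hx0, if_pos rfl,
        if_neg (fun h => hxU (hsub _ h))] at h1
      rw [ucd_count_int, if_neg hy0, if_neg hy0, hext y hy0, if_pos rfl, if_pos hy] at h2
      have h3 : 2 * ((u : ℤ) * eta) - (-(q : ℤ)) ^ beta = 0 := by linarith
      refine ⟨w * (((u : ℤ) * eta) ^ 2 + (u : ℤ) * eta), hshape, fun z => ?_⟩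
      by_cases hz0 : z = 0
      · subst hz0
        rw [if_pos rfl, hz.1]; rfl
      · rw [if_neg hz0, (hfam z hz0).1, h3]; ring
  · obtain ⟨x, hx0, hxU⟩ := hout hS
    rintro ⟨lam, -, hlam⟩
    have h1 := hlam x
    have h2 := hlam y
    rw [(hfam x hx0).2, if_neg hxU, if_neg hx0] at h1
    rw [(hfam y hy0).2, if_pos hyU, if_neg hy0] at h2
    have h3 : 2 * ((w : ℤ) - 1) * ((u : ℤ) * eta) = 0 := by linarith
    have hw' : (w : ℤ) - 1 ≠ 0 := by omega
    have hu' : (u : ℤ) ≠ 0 := by omega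
    exact mul_ne_zero (mul_ne_zero two_ne_zero hw') (mul_ne_zero hu' heta0) h3
end

section
/- Let GF(q) be a finite field of order q = ef + 1 = ερ + 1 with e, f, ε, ρ > 1, ε | e and e > ε, and suppose C₀^ε is a (q, (q−1)/ε, λ)-difference set (so λ = (q−1−ε)/ε²). Let C₀^ε′ = {C₀^e, C_ε^e, …, C_{e−ε}^e}. Then: (i) if φ_i ≠ φ_j for some distinct i, j ∈ {1, …, ε−1}, then C₀^ε′ is neither a disjoint partial difference family nor an external partial difference family; (ii) otherwise, C₀^ε′ is a (q, e/ε, f, (f−1)/ε)-disjoint difference family and a (q, e/ε, f, (e−ε)f/ε²)-external difference family. In particular, C₀^ε′ can never be a proper disjoint partial difference family nor a proper external partial difference family. -/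
open Finset

lemma aux_count_int {G : Type*} [AddCommGroup G] [DecidableEq G] (D : Finset G) (x : G)
    (hx : x ≠ 0) : (intDiff D).count x = (D.filter fun d => d + x ∈ D).card := by
  unfold intDiff
  rw [Multiset.count_map, ← Finset.filter_val, Finset.card_val]
  symm
  refine Finset.card_bij (fun d _ => (d + x, d)) ?_ ?_ ?_
  · intro d hd
    simp only [Finset.mem_filter, Finset.mem_product] at hd ⊢
    refine ⟨⟨⟨hd.2, hd.1⟩, by simpa using hx⟩, by simp⟩
  · intro a _ b _ h
    simpa using congrArg Prod.snd h
  · rintro ⟨a, b⟩ h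
    simp only [Finset.mem_filter, Finset.mem_product] at h
    obtain ⟨⟨⟨h1, h2⟩, h3⟩, h4⟩ := h
    have : b + x = a := by rw [h4]; abel
    exact ⟨b, by simp [h2, this, h1], by simp [this]⟩

lemma aux_count_ext {G : Type*} [AddCommGroup G] [DecidableEq G] (A B : Finset G) (x : G) :
    (extDiff A B).count x = (B.filter fun d => d + x ∈ A).card := by
  unfold extDiff
  rw [Multiset.count_map, ← Finset.filter_val, Finset.card_val]
  symm
  refine Finset.card_bij (fun d _ => (d + x, d)) ?_ ?_ ?_
  · intro d hd
    simp only [Finset.mem_filter, Finset.mem_product] at hd ⊢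
    refine ⟨⟨hd.2, hd.1⟩, by simp⟩
  · intro a _ b _ h
    simpa using congrArg Prod.snd h
  · rintro ⟨a, b⟩ h
    simp only [Finset.mem_filter, Finset.mem_product] at h
    obtain ⟨⟨h1, h2⟩, h4⟩ := h
    have : b + x = a := by rw [h4]; abel
    exact ⟨b, by simp [h2, this, h1], by simp [this]⟩

lemma aux_int_zero {G : Type*} [AddCommGroup G] [DecidableEq G] (D : Finset G) :
    (intDiff D).count 0 = 0 := by
  unfold intDiff
  rw [Multiset.count_eq_zero]
  simp only [Multiset.mem_map, Finset.mem_val, Finset.mem_filter, not_exists, not_and]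
  rintro p ⟨_, h⟩ h2
  exact h (sub_eq_zero.mp h2)

lemma aux_int_card {G : Type*} [AddCommGroup G] [DecidableEq G] (D : Finset G) :
    (intDiff D).card = D.card * D.card - D.card := by
  unfold intDiff
  rw [Multiset.card_map, Finset.card_val, ← Finset.offDiag_card]
  congr 1
  ext p
  simp [Finset.mem_offDiag, and_assoc]

lemma aux_sum_count {G : Type*} [AddCommGroup G] [Fintype G] [DecidableEq G] (M : Multiset G)
    (c : ℤ) (h : ∀ x : G, (M.count x : ℤ) = if x = 0 then 0 else c) :
    (M.card : ℤ) = (Fintype.card G - 1) * c := by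
  have h1 : M.card = ∑ x : G, M.count x := by
    rw [Multiset.sum_count_eq_card]
    intro a _
    exact Finset.mem_univ a
  rw [h1]
  push_cast
  rw [Finset.sum_congr rfl (fun x _ => h x), ← Finset.add_sum_erase _ _ (Finset.mem_univ (0 : G))]
  rw [if_pos rfl, Finset.sum_congr rfl (g := fun _ => c)]
  · rw [Finset.sum_const, Finset.card_erase_of_mem (Finset.mem_univ _), Finset.card_univ]
    have : 1 ≤ Fintype.card G := Fintype.card_pos
    simp [Nat.cast_sub this]
  · intro x hx
    rw [if_neg (Finset.ne_of_mem_erase hx)]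

lemma aux_int_neg {G : Type*} [AddCommGroup G] [DecidableEq G] (D : Finset G) (x : G)
    (hx : x ≠ 0) : (intDiff D).count (-x) = (intDiff D).count x := by
  rw [aux_count_int D x hx, aux_count_int D (-x) (neg_ne_zero.mpr hx)]
  refine Finset.card_bij (fun d _ => d + -x) ?_ ?_ ?_
  · intro d hd
    simp only [Finset.mem_filter] at hd ⊢
    exact ⟨hd.2, by simpa using hd.1⟩
  · intro a _ b _ h
    simpa using h
  · intro b hb
    simp only [Finset.mem_filter] at hb
    exact ⟨b + x, by simp [hb.1, hb.2], by simp⟩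

lemma aux_famInt_count {G : Type*} [AddCommGroup G] [DecidableEq G] {ι : Type*} [Fintype ι]
    [DecidableEq ι] (D : ι → Finset G) (x : G) :
    (famInt D).count x = ∑ i, (intDiff (D i)).count x := by
  unfold famInt
  rw [Multiset.count_sum']

lemma aux_famExt_count {G : Type*} [AddCommGroup G] [DecidableEq G] {ι : Type*} [Fintype ι]
    [DecidableEq ι] (D : ι → Finset G) (x : G) :
    (famExt D).count x = ∑ i, ∑ j, if j = i then 0 else ((D j).filter fun d => d + x ∈ D i).card := by
  unfold famExt
  simp only [Multiset.count_sum']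
  refine Finset.sum_congr rfl fun i _ => Finset.sum_congr rfl fun j _ => ?_
  split_ifs
  · simp
  · exact aux_count_ext _ _ _

lemma aux_total {G : Type*} [AddCommGroup G] [DecidableEq G] {ι : Type*} [Fintype ι]
    [DecidableEq ι] (D : ι → Finset G) (hD : ∀ i j, i ≠ j → Disjoint (D i) (D j)) (x : G)
    (hx : x ≠ 0) :
    (famInt D).count x + (famExt D).count x = (intDiff (famU D)).count x := by
  rw [aux_famInt_count, aux_famExt_count, aux_count_int _ x hx, ← Finset.sum_add_distrib]
  have h1 : ∀ i, ((intDiff (D i)).count x +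
      ∑ j, if j = i then 0 else ((D j).filter fun d => d + x ∈ D i).card) =
      ∑ j, ((D j).filter fun d => d + x ∈ D i).card := by
    intro i
    rw [aux_count_int _ x hx, ← Finset.add_sum_erase _ _ (Finset.mem_univ i),
      ← Finset.add_sum_erase (a := i) _ (fun j => ((D j).filter fun d => d + x ∈ D i).card)
        (Finset.mem_univ i), if_pos rfl, zero_add]
    congr 1
    refine Finset.sum_congr rfl fun j hj => ?_
    rw [if_neg (Finset.ne_of_mem_erase hj)]
  simp only [h1]
  rw [Finset.sum_comm]
  have h2 : ∀ j, ∑ i, ((D j).filter fun d => d + x ∈ D i).card =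
      ((D j).filter fun d => d + x ∈ famU D).card := by
    intro j
    rw [← Finset.card_biUnion]
    · congr 1
      ext d
      simp [famU]
    · intro a _ b _ hab
      refine Finset.disjoint_left.mpr ?_
      intro d h1 h2
      simp only [Finset.mem_filter] at h1 h2
      exact Finset.disjoint_left.mp (hD a b hab) h1.2 h2.2
  simp only [h2]
  rw [← Finset.card_biUnion]
  · congr 1
    ext d
    simp [famU]
  · intro a _ b _ hab
    exact (hD a b hab).mono (Finset.filter_subset _ _) (Finset.filter_subset _ _)

lemma aux_ext_zero {G : Type*} [AddCommGroup G] [DecidableEq G] {ι : Type*} [Fintype ι]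
    [DecidableEq ι] (D : ι → Finset G) (hD : ∀ i j, i ≠ j → Disjoint (D i) (D j)) :
    (famExt D).count 0 = 0 := by
  rw [aux_famExt_count]
  refine Finset.sum_eq_zero fun i _ => Finset.sum_eq_zero fun j _ => ?_
  split_ifs with h
  · rfl
  · rw [Finset.card_eq_zero, Finset.filter_eq_empty_iff]
    intro d hd h2
    rw [add_zero] at h2
    exact Finset.disjoint_left.mp (hD j i h) hd h2

lemma aux_alpha_order {F : Type*} [Field F] [Fintype F] (α : F)
    (hα : IsPrimitiveElt α) (hq : 3 ≤ Fintype.card F) :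
    α ≠ 0 ∧ orderOf α = Fintype.card F - 1 := by
  classical
  have h0 : α ≠ 0 := by
    rintro rfl
    have : (Finset.univ : Finset F) ⊆ {0, 1} := by
      intro x _
      by_cases hx : x = 0
      · simp [hx]
      · obtain ⟨k, hk⟩ := hα x hx
        rcases Nat.eq_zero_or_pos k with rfl | hk0
        · simp [hk]
        · rw [zero_pow hk0.ne'] at hk
          exact absurd hk hx
    have h2 := Finset.card_le_card this
    have h3 := Finset.card_le_two (a := (0 : F)) (b := 1)
    rw [Finset.card_univ] at h2
    omega
  refine ⟨h0, ?_⟩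
  have h := orderOf_eq_card_of_forall_mem_zpowers (g := Units.mk0 α h0) (fun u => by
    obtain ⟨k, hk⟩ := hα u u.ne_zero
    refine ⟨k, ?_⟩
    ext
    simp [hk])
  rw [← orderOf_units, Units.val_mk0] at h
  rw [h, Nat.card_eq_fintype_card, Fintype.card_units]

lemma aux_mem {F : Type*} [Field F] [DecidableEq F] (α : F) (h0 : α ≠ 0) (e f : ℕ)
    (hf : 0 < f) (ho : orderOf α = e * f) (i n : ℕ) :
    α ^ n ∈ cyclo α e f i ↔ n ≡ i [MOD e] := by
  unfold cyclo
  simp only [Finset.mem_image, Finset.mem_range]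
  constructor
  · rintro ⟨j, _, h⟩
    have hinj : α ^ (i + e * j) = α ^ n ↔ (i + e * j) ≡ n [MOD orderOf α] := by
      have := pow_inj_mod (x := Units.mk0 α h0) (n := i + e * j) (m := n)
      rw [← orderOf_units, Units.val_mk0] at this
      rw [Nat.ModEq, ← this, Units.ext_iff]
      simp
    rw [hinj, ho] at h
    have h2 : i + e * j ≡ n [MOD e] := h.of_mul_right f
    have h3 : i + e * j ≡ i [MOD e] := by simp [Nat.ModEq]
    exact h2.symm.trans h3
  · intro h
    have hper : ∀ m : ℕ, α ^ (m % (e * f)) = α ^ m := by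
      intro m
      rw [← ho, pow_mod_orderOf]
    rcases Nat.eq_zero_or_pos e with rfl | he
    · have : n = i := by simpa [Nat.ModEq] using h
      exact ⟨0, hf, by simp [this]⟩
    -- shift n to be large
    have h2 : i ≤ n + (e * f) * i := by
      have : 1 ≤ e * f := Nat.mul_pos he hf
      nlinarith
    have h3 : i ≡ n + (e * f) * i [MOD e] := by
      have : n + (e * f) * i ≡ n [MOD e] := by
        rw [mul_assoc]; simp [Nat.ModEq]
      exact (this.trans h).symm
    obtain ⟨k, hk⟩ := (Nat.modEq_iff_dvd' h2).mp h3
    have h4 : n + (e * f) * i = i + e * k := by omega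
    refine ⟨k % f, Nat.mod_lt _ hf, ?_⟩
    have h5 : α ^ (e * (k % f)) = α ^ (e * k) := by
      rw [← Nat.mul_mod_mul_left, hper]
    rw [pow_add, h5, ← pow_add, ← h4, pow_add, pow_mul, ← ho, pow_orderOf_eq_one]
    simp

lemma aux_zero_mem {F : Type*} [Field F] [DecidableEq F] (α : F) (h0 : α ≠ 0) (e f i : ℕ) :
    (0 : F) ∉ cyclo α e f i := by
  unfold cyclo
  simp only [Finset.mem_image, not_exists, not_and]
  intro j _ h
  exact pow_ne_zero _ h0 h

lemma aux_card {F : Type*} [Field F] [DecidableEq F] (α : F) (h0 : α ≠ 0) (e f : ℕ)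
    (hf : 0 < f) (he : 0 < e) (ho : orderOf α = e * f) (i : ℕ) :
    (cyclo α e f i).card = f := by
  unfold cyclo
  rw [Finset.card_image_of_injOn, Finset.card_range]
  intro a ha b hb h
  simp only [Finset.coe_range, Set.mem_Iio] at ha hb
  simp only [pow_add] at h
  have h := mul_left_cancel₀ (pow_ne_zero _ h0) h
  have := pow_injOn_Iio_orderOf (x := α) (x₁ := e * a) (x₂ := e * b)
    (by simp [ho, he, ha]) (by simp [ho, he, hb]) h
  exact Nat.eq_of_mul_eq_mul_left he this

/-- Arithmetic core of the characteristic two case. -/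
lemma aux_arith (ε ρ n t : ℕ) (hε : 1 < ε) (hρ : 1 < ρ) (h1 : 2 ^ n = ε * ρ + 1)
    (h2 : 4 * (t * (t + 1)) = (ε - 1) * 2 ^ n) : False := by
  obtain ⟨n, rfl⟩ : ∃ m, n = m + 3 := by
    have : 3 ≤ n := by
      by_contra hn
      have : n = 0 ∨ n = 1 ∨ n = 2 := by omega
      have h5 : 4 ≤ ε * ρ := by nlinarith
      rcases this with rfl | rfl | rfl <;> norm_num at h1 <;> omega
    exact ⟨n - 3, by omega⟩
  have hodd : Odd (ε * ρ) := by
    have : ε * ρ + 1 = 2 * (2 ^ (n + 2)) := by rw [← h1]; ring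
    exact ⟨2 ^ (n + 2) - 1, by have : 1 ≤ 2 ^ (n + 2) := Nat.one_le_two_pow
                               omega⟩
  obtain ⟨hεo, hρo⟩ := Nat.odd_mul.mp hodd
  have hρ3 : 3 ≤ ρ := by obtain ⟨r, hr⟩ := hρo; omega
  obtain ⟨u, rfl⟩ : ∃ u, ε = u + 1 := ⟨ε - 1, by omega⟩
  simp only [Nat.add_sub_cancel] at h2
  have hQe : Even (2 ^ (n + 1)) := ⟨2 ^ n, by ring⟩
  have hpQ : (2 : ℕ) ^ (n + 3) = 4 * 2 ^ (n + 1) := by ring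
  have hco : Nat.Coprime t (t + 1) := by simp
  have hdv : 2 ^ (n + 1) ∣ t ∨ 2 ^ (n + 1) ∣ (t + 1) := by
    have hd : 2 ^ (n + 1) ∣ t * (t + 1) := ⟨u, by rw [hpQ] at h2; linarith⟩
    rcases Nat.even_or_odd t with ht | ht
    · left
      refine Nat.Coprime.dvd_of_dvd_mul_right ?_ hd
      exact Nat.Coprime.pow_left _ (Nat.coprime_two_left.mpr ht.add_one)
    · right
      refine Nat.Coprime.dvd_of_dvd_mul_left ?_ hd
      exact Nat.Coprime.pow_left _ (Nat.coprime_two_left.mpr ht)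
  rw [hpQ] at h1 h2
  have hQ2 : 2 ≤ 2 ^ (n + 1) := by
    have : 1 ≤ 2 ^ n := Nat.one_le_two_pow
    rw [pow_succ]; omega
  generalize 2 ^ (n + 1) = Q at *
  have hb : 3 * (u + 1) + 1 ≤ 4 * Q := by nlinarith
  have hue : Even u := by
    rcases hεo with ⟨r, hr⟩
    exact ⟨r, by omega⟩
  rcases hdv with ⟨c, hc⟩ | ⟨c, hc⟩
  · have h3 : c * (Q * c + 1) = u := by
      have : Q * (c * (Q * c + 1)) = Q * u := by rw [hc] at h2; nlinarith
      exact Nat.eq_of_mul_eq_mul_left (by omega) this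
    rcases Nat.lt_or_ge c 2 with h | h
    · have : c = 0 ∨ c = 1 := by omega
      rcases this with rfl | rfl
      · omega
      · obtain ⟨a, ha⟩ := hue
        obtain ⟨b, hb'⟩ := hQe
        omega
    · nlinarith
  · have h3 : c * t = u := by
      have : Q * (c * t) = Q * u := by rw [hc] at h2; nlinarith
      exact Nat.eq_of_mul_eq_mul_left (by omega) this
    rcases Nat.lt_or_ge c 2 with h | h
    · have : c = 0 ∨ c = 1 := by omega
      rcases this with rfl | rfl
      · omega
      · obtain ⟨a, ha⟩ := hue
        obtain ⟨b, hb'⟩ := hQe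
        omega
    · have : 2 * Q ≤ t + 1 := by nlinarith
      nlinarith

lemma aux_even {F : Type*} [Field F] [DecidableEq F] (H P : Finset F) (x : F)
    (hneg : ∀ y ∈ H, -y ∈ H) (hP : P ⊆ H.filter fun d => d + x ∈ H)
    (hP' : ∀ d ∈ H, d + x ∈ H → (d ∈ P ↔ -(d + x) ∈ P)) (hfix : ∀ d ∈ P, -(d + x) ≠ d) :
    Even P.card := by
  have h : ∑ _d ∈ P, (1 : ZMod 2) = 0 := by
    refine Finset.sum_involution (fun d _ => -(d + x)) ?_ ?_ ?_ ?_
    · intro a _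
      decide
    · intro a ha _
      exact hfix a ha
    · intro a ha
      have := hP ha
      simp only [Finset.mem_filter] at this
      exact (hP' a this.1 this.2).mp ha
    · intro a _
      ring
  rw [Finset.sum_const, nsmul_eq_mul, mul_one] at h
  exact (ZMod.natCast_eq_zero_iff_even).mp h

lemma aux_odd_case {F : Type*} [Field F] [DecidableEq F] (H : Finset F) (l : ℕ) (a : F)
    (h2 : (2 : F) ≠ 0) (hneg : ∀ y ∈ H, -y ∈ H) (h1 : (1 : F) ∈ H) (ha0 : a ≠ 0) (ha : a ∉ H)
    (hc : ∀ x : F, x ≠ 0 → (H.filter fun d => d + x ∈ H).card = l) : False := by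
  have e1 : Even l := by
    rw [← hc (-(2 * a)) (by simp [h2, ha0])]
    refine aux_even H _ (-(2 * a)) hneg (le_refl _) ?_ ?_
    · intro d hd hd'
      have := hneg _ hd
      have h3 := hneg _ hd'
      simp only [Finset.mem_filter]
      refine ⟨fun _ => ⟨h3, ?_⟩, fun _ => ⟨hd, hd'⟩⟩
      have h4 : -(d + -(2 * a)) + -(2 * a) = -d := by ring
      rwa [h4]
    · intro d hd h
      simp only [Finset.mem_filter] at hd
      have h5 : 2 * (d - a) = 0 := by linear_combination -h
      have h6 : d = a := by
        rcases mul_eq_zero.mp h5 with h | h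
        · exact absurd h h2
        · exact sub_eq_zero.mp h
      exact ha (h6 ▸ hd.1)
  have hm : (1 : F) ∈ H.filter fun d => d + -2 ∈ H := by
    simp only [Finset.mem_filter]
    refine ⟨h1, ?_⟩
    have : (1 : F) + -2 = -1 := by ring
    rw [this]
    exact hneg _ h1
  have e2 : Even (((H.filter fun d => d + -2 ∈ H).erase 1).card) := by
    refine aux_even H _ (-2) hneg (Finset.erase_subset _ _) ?_ ?_
    · intro d hd hd'
      have := hneg _ hd
      have h3 := hneg _ hd'
      have h4 : -(d + -2) + -2 = -d := by ring
      simp only [Finset.mem_erase, Finset.mem_filter, h4]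
      constructor
      · rintro ⟨h, _⟩
        refine ⟨fun h' => h ?_, h3, this⟩
        linear_combination -h'
      · rintro ⟨h, _⟩
        refine ⟨fun h' => h ?_, hd, hd'⟩
        linear_combination -h'
    · intro d hd h
      have h5 : 2 * (d - 1) = 0 := by linear_combination -h
      have h6 : d = 1 := by
        rcases mul_eq_zero.mp h5 with h | h
        · exact absurd h h2
        · exact sub_eq_zero.mp h
      exact Finset.ne_of_mem_erase hd h6
  have h7 := Finset.card_erase_add_one hm
  rw [hc (-2) (by simpa using h2)] at h7
  rw [← h7] at e1
  exact (Nat.not_even_iff_odd.mpr e2.add_one) e1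

lemma aux_char_two {F : Type*} [Field F] [Fintype F] [DecidableEq F] (H : Finset F) (l : ℕ)
    (h2 : (2 : F) = 0) 
    (hc : ∀ x : F, x ≠ 0 → (H.filter fun d => d + x ∈ H).card = l) :
    ∃ s : ℤ, s ^ 2 = H.card - l := by
  have hch : CharP F 2 := CharTwo.of_one_ne_zero_of_two_eq_zero one_ne_zero h2
  let _ : Algebra (ZMod 2) F := ZMod.algebra F 2
  obtain ⟨φ, hφ⟩ : ∃ φ : Module.Dual (ZMod 2) F, φ 1 ≠ 0 := by
    by_contra! h
    exact one_ne_zero ((Module.forall_dual_apply_eq_zero_iff (ZMod 2) (1 : F)).mp h)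
  have hz : ∀ a b : ZMod 2, (if a + b = 0 then (1 : ℤ) else -1) =
      (if a = 0 then 1 else -1) * (if b = 0 then 1 else -1) := by decide
  let ψ : AddChar F ℤ :=
    { toFun := fun x => if φ x = 0 then 1 else -1
      map_zero_eq_one' := by simp
      map_add_eq_mul' := fun a b => by rw [map_add]; exact hz _ _ }
  have hψ : ψ ≠ 1 := by
    intro h
    have h3 : ψ 1 = 1 := by rw [h]; rfl
    have h4 : ψ 1 = -1 := if_neg hφ
    omega
  have hsum : ∑ x, ψ x = 0 := AddChar.sum_eq_zero_of_ne_one hψ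
  refine ⟨∑ x ∈ H, ψ x, ?_⟩
  have key : ∀ y : F, ∑ x ∈ H, ψ (x + y) = ∑ z : F, if y + z ∈ H then ψ z else 0 := by
    intro y
    rw [← Finset.sum_filter]
    refine Finset.sum_bij (fun x _ => x + y) ?_ ?_ ?_ ?_
    · intro x hx
      have : y + (x + y) = x := by linear_combination y * h2
      simp [this, hx]
    · intro a _ b _ h
      simpa using h
    · intro z hz
      simp only [Finset.mem_filter] at hz
      exact ⟨y + z, hz.2, by linear_combination y * h2⟩
    · intro x _
      rfl
  calc (∑ x ∈ H, ψ x) ^ 2 = ∑ y ∈ H, ∑ x ∈ H, ψ (x + y) := by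
        rw [sq, Finset.sum_mul_sum, Finset.sum_comm]
        simp only [AddChar.map_add_eq_mul]
    _ = ∑ y ∈ H, ∑ z : F, if y + z ∈ H then ψ z else 0 := by simp only [key]
    _ = ∑ z : F, ((H.filter fun d => d + z ∈ H).card : ℤ) * ψ z := by
        rw [Finset.sum_comm]
        refine Finset.sum_congr rfl fun z _ => ?_
        rw [← Finset.sum_filter, Finset.sum_const, nsmul_eq_mul]
    _ = ∑ z : F, ((l : ℤ) * ψ z + if z = 0 then (H.card : ℤ) - l else 0) := by
        refine Finset.sum_congr rfl fun z _ => ?_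
        by_cases hz : z = 0
        · subst hz
          simp
        · rw [hc z hz, if_neg hz, add_zero]
    _ = (H.card : ℤ) - l := by
        rw [Finset.sum_add_distrib, ← Finset.mul_sum, hsum]
        simp

lemma aux_neg_one {F : Type*} [Field F] [Fintype F] [DecidableEq F] (ε ρ l : ℕ) (α : F)
    (h0 : α ≠ 0) (ho : orderOf α = ε * ρ) (hα : IsPrimitiveElt α)
    (hq : Fintype.card F = ε * ρ + 1) (hε : 1 < ε) (hρ : 1 < ρ) (hl : l * ε = ρ - 1)
    (hc : ∀ x : F, x ≠ 0 →
      ((cyclo α ε ρ 0).filter fun d => d + x ∈ cyclo α ε ρ 0).card = l) :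
    (-1 : F) ∉ cyclo α ε ρ 0 := by
  have hmem := aux_mem α h0 ε ρ (by omega) ho 0
  intro hneg1
  by_cases h2 : (2 : F) = 0
  · obtain ⟨s, hs⟩ := aux_char_two _ l h2 hc
    rw [aux_card α h0 ε ρ (by omega) (by omega) ho] at hs
    have hch : CharP F 2 := CharTwo.of_one_ne_zero_of_two_eq_zero one_ne_zero h2
    obtain ⟨n, _, hn⟩ := FiniteField.card F 2
    rw [hq] at hn
    have hl' : (l : ℤ) * ε = ρ - 1 := by
      have : l * ε + 1 = ρ := by omega
      rw [← this]; push_cast; ring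
    have hn' : (ε : ℤ) * ρ + 1 = 2 ^ (n : ℕ) := by exact_mod_cast hn
    have hT : ((ε : ℤ) * s) ^ 2 = (ε - 1) * 2 ^ (n : ℕ) + 1 := by
      rw [← hn', mul_pow, hs]
      linear_combination (-(ε : ℤ)) * hl'
    have hT2 : (ε * s.natAbs) ^ 2 = (ε - 1) * 2 ^ (n : ℕ) + 1 := by
      zify [hε.le]
      rw [mul_pow, sq_abs, ← mul_pow, hT]
    have hodd : Odd (ε * s.natAbs) := by
      have : Odd ((ε * s.natAbs) ^ 2) := by
        rw [hT2]
        refine Even.add_one (Even.mul_left ?_ _)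
        exact (Nat.even_pow).mpr ⟨even_two, n.ne_zero⟩
      exact (Nat.odd_pow_iff two_ne_zero).mp this
    obtain ⟨t, ht⟩ := hodd
    refine aux_arith ε ρ n t hε hρ hn.symm ?_
    rw [ht] at hT2
    have : (2 * t + 1) ^ 2 = 4 * (t * (t + 1)) + 1 := by ring
    omega
  · refine aux_odd_case (cyclo α ε ρ 0) l α h2 ?_ ?_ h0 ?_ hc
    · intro y hy
      have hy0 : y ≠ 0 := fun h => aux_zero_mem α h0 ε ρ 0 (h ▸ hy)
      obtain ⟨a, ha⟩ := hα y hy0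
      obtain ⟨b, hb⟩ := hα (-1) (by simp)
      have : -y = α ^ (b + a) := by rw [pow_add, ← ha, ← hb]; ring
      rw [this, hmem]
      rw [ha, hmem] at hy
      rw [hb, hmem] at hneg1
      exact hneg1.add hy
    · have := (hmem 0).mpr rfl
      simpa using this
    · have := hmem 1
      rw [pow_one] at this
      rw [this]
      intro h
      have := (Nat.modEq_zero_iff_dvd).mp h
      have := Nat.le_of_dvd one_pos this
      omega


lemma aux_index (e ε a : ℕ) (he : 0 < e) (hd : ε ∣ e) (ha : a ≡ 0 [MOD ε]) :
    ∃ k : Fin (e / ε), a ≡ ε * (k : ℕ) [MOD e] := by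
  obtain ⟨m, rfl⟩ := hd
  have hε : 0 < ε := Nat.pos_of_mul_pos_right he
  obtain ⟨c, rfl⟩ := (Nat.modEq_zero_iff_dvd).mp ha
  have hm : 0 < m := Nat.pos_of_mul_pos_left he
  refine ⟨⟨c % m, ?_⟩, ?_⟩
  · rw [Nat.mul_div_cancel_left _ hε]
    exact Nat.mod_lt _ hm
  · exact ((Nat.mod_modEq c m).symm).mul_left' ε

lemma aux_famU {F : Type*} [Field F] [DecidableEq F] (e f ε ρ : ℕ) (α : F)
    (h0 : α ≠ 0) (hα : IsPrimitiveElt α) (ho : orderOf α = e * f) (ho' : orderOf α = ε * ρ)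
    (he : 0 < e) (hf : 0 < f) (hρ : 0 < ρ) (hd : ε ∣ e) :
    famU (fun i : Fin (e / ε) => cyclo α e f (ε * (i : ℕ))) = cyclo α ε ρ 0 := by
  ext x
  simp only [famU, Finset.mem_biUnion, Finset.mem_univ, true_and]
  by_cases hx : x = 0
  · subst hx
    simp [aux_zero_mem α h0]
  · obtain ⟨a, rfl⟩ := hα x hx
    simp only [aux_mem α h0 e f hf ho, aux_mem α h0 ε ρ hρ ho']
    constructor
    · rintro ⟨k, hk⟩
      refine (hk.of_dvd hd).trans ?_
      simp [Nat.ModEq]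
    · exact aux_index e ε a he hd

lemma aux_disj {F : Type*} [Field F] [DecidableEq F] (e f ε : ℕ) (α : F)
    (h0 : α ≠ 0) (hα : IsPrimitiveElt α) (ho : orderOf α = e * f)
    (he : 0 < e) (hf : 0 < f) (hd : ε ∣ e) (i j : Fin (e / ε)) (hij : i ≠ j) :
    Disjoint (cyclo α e f (ε * (i : ℕ))) (cyclo α e f (ε * (j : ℕ))) := by
  rw [Finset.disjoint_left]
  intro x h1 h2
  have hx : x ≠ 0 := fun h => aux_zero_mem α h0 _ _ _ (h ▸ h1)
  obtain ⟨a, rfl⟩ := hα x hx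
  rw [aux_mem α h0 e f hf ho] at h1 h2
  have h3 := h1.symm.trans h2
  obtain ⟨m, rfl⟩ := hd
  have hε : 0 < ε := Nat.pos_of_mul_pos_right he
  have h4 := Nat.ModEq.mul_left_cancel' hε.ne' h3
  have hi := i.2
  have hj := j.2
  have hm : ε * m / ε = m := Nat.mul_div_cancel_left _ hε
  exact hij (Fin.ext (h4.eq_of_lt_of_lt (by omega) (by omega)))

lemma aux_phi {F : Type*} [Field F] [DecidableEq F] (e f ε ρ : ℕ) (α : F)
    (h0 : α ≠ 0) (hα : IsPrimitiveElt α) (ho : orderOf α = e * f) (ho' : orderOf α = ε * ρ)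
    (he : 0 < e) (hf : 0 < f) (hρ : 0 < ρ) (hd : ε ∣ e) (n i : ℕ) (hn : n ≡ i [MOD ε]) :
    (famInt (fun i : Fin (e / ε) => cyclo α e f (ε * (i : ℕ)))).count (α ^ n) =
      phi α e f ε ρ i := by
  have hM := aux_mem α h0 e f hf ho
  have hM' := aux_mem α h0 ε ρ hρ ho'
  have hx0 : α ^ n ≠ 0 := pow_ne_zero _ h0
  have hxi : α ^ n ∈ cyclo α ε ρ i := (hM' _ _).mpr hn
  rw [aux_famInt_count]
  simp only [aux_count_int _ _ hx0]
  rw [← Finset.card_biUnion]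
  swap
  · intro a _ b _ hab
    exact (aux_disj e f ε α h0 hα ho he hf hd a b hab).mono
      (Finset.filter_subset _ _) (Finset.filter_subset _ _)
  unfold phi
  have hεk : ∀ k, ε * k ≡ 0 [MOD ε] := fun k => by simp [Nat.ModEq]
  refine Finset.card_bij (fun d _ => (d + α ^ n) / d) ?_ ?_ ?_
  · intro d hdm
    simp only [Finset.mem_biUnion, Finset.mem_univ, true_and, Finset.mem_filter] at hdm
    obtain ⟨k, h1, h2⟩ := hdm
    have hd0 : d ≠ 0 := fun h => aux_zero_mem α h0 _ _ _ (h ▸ h1)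
    have hd1 : d + α ^ n ≠ 0 := fun h => aux_zero_mem α h0 _ _ _ (h ▸ h2)
    obtain ⟨c, hc⟩ := hα ((d + α ^ n) / d) (div_ne_zero hd1 hd0)
    obtain ⟨g, hg⟩ := hα (α ^ n / d) (div_ne_zero hx0 hd0)
    obtain ⟨a, rfl⟩ := hα d hd0
    have e1 : α ^ a + α ^ n = α ^ (c + a) := by
      rw [pow_add, ← hc, div_mul_cancel₀ _ hd0]
    have e2 : α ^ n = α ^ (g + a) := by
      rw [pow_add, ← hg, div_mul_cancel₀ _ hd0]
    have e3 : (α ^ a + α ^ n) / α ^ a - 1 = α ^ n / α ^ a := by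
      field_simp
      ring
    rw [e1, hM] at h2
    rw [hM] at h1
    rw [e2, hM'] at hxi
    have ha0 : a ≡ 0 [MOD ε] := (h1.of_dvd hd).trans (hεk k)
    simp only [Phi, Finset.mem_filter]
    refine ⟨?_, ?_, ?_⟩
    · rw [hc, hM]
      refine Nat.ModEq.add_right_cancel' a ?_
      rw [zero_add]
      exact h2.trans h1.symm
    · intro h
      rw [h, sub_self] at e3
      exact div_ne_zero hx0 hd0 e3.symm
    · rw [e3, hg, hM']
      refine Nat.ModEq.add_right_cancel' a ?_
      refine hxi.trans ?_
      simpa using (ha0.symm.add_left i)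
  · intro a ha b hb h
    simp only [Finset.mem_biUnion, Finset.mem_univ, true_and, Finset.mem_filter] at ha hb
    obtain ⟨k, h1, -⟩ := ha
    obtain ⟨k', h1', -⟩ := hb
    have ha0 : a ≠ 0 := fun h => aux_zero_mem α h0 _ _ _ (h ▸ h1)
    have hb0 : b ≠ 0 := fun h => aux_zero_mem α h0 _ _ _ (h ▸ h1')
    rw [div_eq_div_iff ha0 hb0] at h
    have : α ^ n * (b - a) = 0 := by linear_combination h
    rcases mul_eq_zero.mp this with h | h
    · exact absurd h hx0
    · exact (sub_eq_zero.mp h).symm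
  · intro y hy
    simp only [Phi, Finset.mem_filter] at hy
    obtain ⟨h1, h2, h3⟩ := hy
    have hy0 : y ≠ 0 := fun h => aux_zero_mem α h0 _ _ _ (h ▸ h1)
    have hy1 : y - 1 ≠ 0 := sub_ne_zero.mpr h2
    have hd0 : α ^ n / (y - 1) ≠ 0 := div_ne_zero hx0 hy1
    obtain ⟨a, ha⟩ := hα _ hd0
    obtain ⟨g, hg⟩ := hα _ hy1
    obtain ⟨c, hc⟩ := hα _ hy0
    have e1 : α ^ n = α ^ (a + g) := by
      rw [pow_add, ← ha, ← hg, div_mul_cancel₀ _ hy1]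
    have e2 : α ^ a + α ^ n = α ^ (c + a) := by
      rw [e1, pow_add, ← hg, pow_add, ← hc]
      ring
    rw [e1, hM'] at hxi
    rw [hg, hM'] at h3
    rw [hc, hM] at h1
    have ha0 : a ≡ 0 [MOD ε] := by
      refine Nat.ModEq.add_right_cancel' g ?_
      rw [zero_add]
      exact hxi.trans h3.symm
    obtain ⟨k, hk⟩ := aux_index e ε a he hd ha0
    refine ⟨α ^ a, ?_, ?_⟩
    · simp only [Finset.mem_biUnion, Finset.mem_univ, true_and, Finset.mem_filter]
      refine ⟨k, (hM _ _).mpr hk, ?_⟩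
      rw [e2, hM]
      simpa using h1.add hk
    · rw [e2, pow_add, ← hc]
      exact mul_div_cancel_right₀ _ (pow_ne_zero _ h0)

/-- Theorem: let `q = ef+1 = ερ+1` with `ε ∣ e`, `e > ε`, and `C₀^ε` a `(q,ρ,λ)`-difference
set.  (i) If `φ_i ≠ φ_j` for some distinct `i,j ∈ {1,…,ε-1}` then `C₀^ε′` is neither a DPDF
nor an EPDF; (ii) otherwise `C₀^ε′` is a `(q,e/ε,f,(f-1)/ε)`-DDF and a
`(q,e/ε,f,(e-ε)f/ε²)`-EDF.  In particular `C₀^ε′` is never a proper DPDF nor a proper EPDF. -/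
theorem partition_of_ds_never_proper {F : Type*} [Field F] [Fintype F] [DecidableEq F]
    (q e f eps rho : ℕ) (lam : ℤ) (α : F)
    (hq : Fintype.card F = q) (hα : IsPrimitiveElt α)
    (hef : q = e * f + 1) (he : 1 < e) (hf : 1 < f)
    (herho : q = eps * rho + 1) (hepse : eps ∣ e) (heps : 1 < eps) (hrho : 1 < rho)
    (hlt : eps < e)
    (hDS : IsDS q rho lam (cyclo α eps rho 0)) :
    ∀ D : Fin (e / eps) → Finset F, D = (fun i : Fin (e / eps) => cyclo α e f (eps * (i : ℕ))) →
    ((∃ i j, 1 ≤ i ∧ i ≤ eps - 1 ∧ 1 ≤ j ∧ j ≤ eps - 1 ∧ i ≠ j ∧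
        phi α e f eps rho i ≠ phi α e f eps rho j) →
      (¬ ∃ a b : ℤ, IsDPDF q (e / eps) f a b D) ∧
      (¬ ∃ a b : ℤ, IsEPDF q (e / eps) f a b D)) ∧
    ((∀ i j, 1 ≤ i → i ≤ eps - 1 → 1 ≤ j → j ≤ eps - 1 →
        phi α e f eps rho i = phi α e f eps rho j) →
      ((∃ a : ℕ, eps * a = f - 1 ∧ IsDDF q (e / eps) f (a : ℤ) D) ∧
       (∃ b : ℕ, eps ^ 2 * b = (e - eps) * f ∧ IsEDF q (e / eps) f (b : ℤ) D))) ∧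
    (∀ a b : ℤ, IsDPDF q (e / eps) f a b D → a = b) ∧
    (∀ a b : ℤ, IsEPDF q (e / eps) f a b D → a = b) := by
  intro D hDdef
  have hq3 : 3 ≤ Fintype.card F := by rw [hq, hef]; nlinarith
  obtain ⟨h0, hord⟩ := aux_alpha_order α hα hq3
  have ho : orderOf α = e * f := by rw [hord, hq, hef]; simp
  have ho' : orderOf α = eps * rho := by rw [hord, hq, herho]; simp
  have hM' := aux_mem α h0 eps rho (by omega) ho'
  have hU : famU D = cyclo α eps rho 0 := by
    rw [hDdef]
    exact aux_famU e f eps rho α h0 hα ho ho' (by omega) (by omega) (by omega) hepse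
  have hdisj : ∀ i j, i ≠ j → Disjoint (D i) (D j) := by
    rw [hDdef]
    exact aux_disj e f eps α h0 hα ho (by omega) (by omega) hepse
  have hphi : ∀ n i : ℕ, n ≡ i [MOD eps] →
      (famInt D).count (α ^ n) = phi α e f eps rho i := by
    rw [hDdef]
    exact aux_phi e f eps rho α h0 hα ho ho' (by omega) (by omega) (by omega) hepse
  have hcard : ∀ i, (D i).card = f := by
    rw [hDdef]
    intro i
    exact aux_card α h0 e f (by omega) (by omega) ho _
  obtain ⟨-, hHc, hDS⟩ := hDS
  have htot : ∀ x : F, x ≠ 0 → ((famInt D).count x : ℤ) + (famExt D).count x = lam := by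
    intro x hx
    have h := aux_total D hdisj x hx
    have h2 := hDS x
    rw [if_neg hx, ← hU, ← h] at h2
    exact_mod_cast h2
  -- the parameter of the difference set
  have hlamnn : 0 ≤ lam := by
    have := htot 1 one_ne_zero
    omega
  obtain ⟨l, rfl⟩ := Int.eq_ofNat_of_zero_le hlamnn
  have hle : l * eps = rho - 1 := by
    have h := aux_sum_count _ _ hDS
    rw [aux_int_card, hHc, hq, herho] at h
    have h1 : rho * rho - rho = eps * rho * l := by
      push_cast at h
      have h' : (((rho * rho - rho : ℕ)) : ℤ) = ((eps * rho * l : ℕ) : ℤ) := by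
        rw [h]; push_cast; ring
      exact_mod_cast h'
    have h2 : rho * (rho - 1) = rho * (l * eps) := by
      rw [Nat.mul_sub, mul_one, h1]; ring
    exact (Nat.eq_of_mul_eq_mul_left (by omega) h2).symm
  have hneg1 : (-1 : F) ∉ famU D := by
    rw [hU]
    refine aux_neg_one eps rho l α h0 ho' hα (by rw [hq, herho]) heps hrho hle ?_
    intro x hx
    have h := hDS x
    rw [if_neg hx, aux_count_int _ x hx] at h
    exact_mod_cast h
  have hone : (1 : F) ∈ famU D := by
    rw [hU]
    have := (hM' 0 0).mpr rfl
    simpa using this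
  have hm10 : (-1 : F) ≠ 0 := by simp
  have hsymm : (famInt D).count (-1) = (famInt D).count 1 := by
    rw [aux_famInt_count, aux_famInt_count]
    exact Finset.sum_congr rfl fun i _ => aux_int_neg _ _ one_ne_zero
  have hnotU : ∀ i, 1 ≤ i → i ≤ eps - 1 → α ^ i ∉ famU D := by
    intro i h1 h2
    rw [hU, hM', Nat.modEq_zero_iff_dvd]
    intro h
    have := Nat.le_of_dvd (by omega) h
    omega
  refine ⟨?_, ?_, ?_, ?_⟩
  · rintro ⟨i, j, hi1, hi2, hj1, hj2, -, hne⟩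
    have hi := hphi i i rfl
    have hj := hphi j j rfl
    have hi0 : α ^ i ≠ 0 := pow_ne_zero _ h0
    have hj0 : α ^ j ≠ 0 := pow_ne_zero _ h0
    constructor
    · rintro ⟨a, b, -, -, h⟩
      have h1 := h (α ^ i)
      have h2 := h (α ^ j)
      rw [if_neg (hnotU i hi1 hi2), if_neg hi0, hi] at h1
      rw [if_neg (hnotU j hj1 hj2), if_neg hj0, hj] at h2
      omega
    · rintro ⟨a, b, -, -, h⟩
      have h1 := h (α ^ i)
      have h2 := h (α ^ j)
      have h3 := htot _ hi0
      have h4 := htot _ hj0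
      rw [if_neg (hnotU i hi1 hi2), if_neg hi0] at h1
      rw [if_neg (hnotU j hj1 hj2), if_neg hj0] at h2
      rw [hi] at h3
      rw [hj] at h4
      omega
  · intro hall
    have hconst' : ∀ n : ℕ, ¬ (n ≡ 0 [MOD eps]) →
        (famInt D).count (α ^ n) = phi α e f eps rho 1 := by
      intro n hn
      rw [hphi n (n % eps) (Nat.mod_modEq _ _).symm]
      have h1 : n % eps < eps := Nat.mod_lt _ (by omega)
      have h2 : n % eps ≠ 0 := by simpa [Nat.ModEq] using hn
      exact hall _ _ (by omega) (by omega) le_rfl (by omega)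
    have hconst : ∀ x : F, x ≠ 0 → (famInt D).count x = phi α e f eps rho 1 := by
      intro x hx
      obtain ⟨n, rfl⟩ := hα x hx
      by_cases hn : n ≡ 0 [MOD eps]
      · rw [hphi n 0 hn, ← hphi 0 0 rfl, pow_zero, ← hsymm]
        obtain ⟨s, hs⟩ := hα (-1) hm10
        rw [hs]
        refine hconst' s ?_
        rwa [hU, hs, hM'] at hneg1
      · exact hconst' n hn
    have hshape : FamShape q (e / eps) f D := ⟨hq, by simp, hcard, hdisj⟩
    have hcnt : ∀ x : F, ((famInt D).count x : ℤ) =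
        if x = 0 then 0 else (phi α e f eps rho 1 : ℤ) := by
      intro x
      split_ifs with hx
      · subst hx
        rw [aux_famInt_count]
        simp [aux_int_zero]
      · exact_mod_cast hconst x hx
    have ha : eps * phi α e f eps rho 1 = f - 1 := by
      have h := aux_sum_count _ _ hcnt
      have h1 : (famInt D).card = (e / eps) * (f * f - f) := by
        unfold famInt
        rw [Multiset.card_sum]
        simp [aux_int_card, hcard]
      rw [h1, hq, hef] at h
      generalize phi α e f eps rho 1 = a at h
      obtain ⟨m, rfl⟩ := hepse
      rw [Nat.mul_div_cancel_left _ (by omega)] at h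
      have h2 : m * (f * f - f) = eps * m * f * a := by
        have h' : ((m * (f * f - f) : ℕ) : ℤ) = ((eps * m * f * a : ℕ) : ℤ) := by
          rw [h]; push_cast; ring
        exact_mod_cast h'
      have hm : 0 < m := Nat.pos_of_mul_pos_left (by omega : 0 < eps * m)
      have h3 : (m * f) * (eps * a) = (m * f) * (f - 1) := by
        have : m * f * (f - 1) = m * (f * f - f) := by
          rw [mul_assoc, Nat.mul_sub, mul_one]
        rw [this, h2]; ring
      exact Nat.eq_of_mul_eq_mul_left (Nat.mul_pos hm (by omega)) h3
    refine ⟨⟨_, ha, hshape, hcnt⟩, (famExt D).count 1, ?_, hshape, ?_⟩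
    · have h1 := htot 1 one_ne_zero
      rw [hconst 1 one_ne_zero] at h1
      generalize (famExt D).count 1 = b at *
      generalize phi α e f eps rho 1 = a at *
      have h2 : a + b = l := by exact_mod_cast h1
      have h3 : eps * rho = e * f := by omega
      zify [hlt.le]
      have k1 : (eps : ℤ) * a = f - 1 := by
        rw [← Nat.cast_mul, ha, Nat.cast_sub (by omega)]; simp
      have k2 : (l : ℤ) * eps = rho - 1 := by
        rw [← Nat.cast_mul, hle, Nat.cast_sub (by omega)]; simp
      have k3 : (eps : ℤ) * rho = e * f := by exact_mod_cast h3
      have k4 : (a : ℤ) + b = l := by exact_mod_cast h2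
      linear_combination (eps : ℤ) ^ 2 * k4 - (eps : ℤ) * k1 + (eps : ℤ) * k2 + k3
    · intro x
      split_ifs with hx
      · subst hx
        rw [aux_ext_zero D hdisj]
        rfl
      · have h1 := htot 1 one_ne_zero
        have h2 := htot x hx
        rw [hconst 1 one_ne_zero] at h1
        rw [hconst x hx] at h2
        omega
  · rintro a b ⟨-, -, h⟩
    have h1 := h 1
    have h2 := h (-1)
    rw [if_pos hone] at h1
    rw [if_neg hneg1, if_neg hm10] at h2
    omega
  · rintro a b ⟨-, -, h⟩
    have h1 := h 1
    have h2 := h (-1)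
    rw [if_pos hone] at h1
    rw [if_neg hneg1, if_neg hm10] at h2
    have h3 := htot 1 one_ne_zero
    have h4 := htot (-1) hm10
    omega
end
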